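/- Let n ≥ 2 and p ≥ 1. For each nonzero nonnegative continuous function f : ℝⁿ → ℝ with compact support there exists a point c ∈ ℝⁿ such that for every ε ∈ [0, 1/2), ‖f‖₁^{n+p} ≤ n^{p} R_{n,p}^{p} ‖f‖_∞^{p} ( ∫_{S^{n−1}} ( ∫_{ℝⁿ} f(x − c) ⟨x,ξ⟩_ε^p dx )^{−n/p} dξ )^{−p}, where ‖f‖_∞ = sup_{x∈ℝⁿ} f(x). -/

import Mathlib

open MeasureTheory Real
open scoped RealInnerProductSpace

/-- The constant `R_{n,p}` from the Haberl–Schuster asymmetric `L_p` Blaschke–Santaló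
inequality: the value of the sharp bound, attained for the Euclidean ball. -/
noncomputable def Rnp (n : ℕ) (p : ℝ) : ℝ :=
  Real.pi ^ ((n : ℝ) / (2 * p) + n) / (Real.Gamma (((n : ℝ) + 2) / 2)) ^ (2 : ℕ) *
    (2 * Real.Gamma (((n : ℝ) + p + 2) / 2) /
      (Real.Gamma (((n : ℝ) + 2) / 2) * Real.Gamma ((p + 1) / 2))) ^ ((n : ℝ) / p)

/-- The asymmetric bracket `⟨x,y⟩_ε^p` applied to a real number `s = ⟨x,y⟩`:
`(1-ε) (max{s,0})^p + ε (max{-s,0})^p`. -/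
noncomputable def epsPow (eps p s : ℝ) : ℝ :=
  (1 - eps) * (max s 0) ^ p + eps * (max (-s) 0) ^ p

open scoped ENNReal Pointwise

/-! ### The Borell–Brascamp–Lieb inequality for negative exponents -/

lemma volume_image_affine {a : ℝ} (ha : 0 < a) (c : ℝ) (K : Set ℝ) :
    volume ((fun x => a * x + c) '' K) = ENNReal.ofReal a * volume K := by
  have : (fun x => a * x + c) '' K = (fun y => y + c) '' ((fun x => a • x) '' K) := by
    rw [Set.image_image]; simp
  rw [this, Set.image_add_right, measure_preimage_add_right, Set.image_smul,
    Measure.addHaar_smul]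
  simp [abs_of_pos ha]

/-- The one-dimensional Brunn–Minkowski inequality. -/
lemma volume_real_brunn_minkowski {a b : ℝ} (ha : 0 < a) (hb : 0 < b) {A B S : Set ℝ}
    (hA : MeasurableSet A) (hB : MeasurableSet B) (hA' : A.Nonempty) (hB' : B.Nonempty)
    (h : ∀ x ∈ A, ∀ y ∈ B, a * x + b * y ∈ S) :
    ENNReal.ofReal a * volume A + ENNReal.ofReal b * volume B ≤ volume S := by
  have key : ∀ K ⊆ A, ∀ M ⊆ B, IsCompact K → IsCompact M → K.Nonempty → M.Nonempty →
      ENNReal.ofReal a * volume K + ENNReal.ofReal b * volume M ≤ volume S := by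
    intro K hKA M hMB hK hM hKn hMn
    obtain ⟨x₀, hx₀, hx₀'⟩ := hK.exists_isGreatest hKn
    obtain ⟨y₀, hy₀, hy₀'⟩ := hM.exists_isLeast hMn
    rw [← volume_image_affine ha (b * y₀), ← volume_image_affine hb (a * x₀)]
    rw [← measure_union₀]
    · apply measure_mono
      rintro _ (⟨x, hx, rfl⟩ | ⟨y, hy, rfl⟩)
      · exact h _ (hKA hx) _ (hMB hy₀)
      · simpa only [add_comm] using h _ (hKA hx₀) _ (hMB hy)
    · exact (hM.image (by fun_prop)).measurableSet.nullMeasurableSet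
    · refine measure_mono_null (t := {a * x₀ + b * y₀}) ?_ (by simp)
      rintro _ ⟨⟨x, hx, rfl⟩, ⟨y, hy, hxy⟩⟩
      have h1 := hx₀' hx
      have h2 := hy₀' hy
      simp only [Set.mem_singleton_iff] at hxy ⊢
      nlinarith
  obtain ⟨x, hx⟩ := hA'
  obtain ⟨y, hy⟩ := hB'
  have key2 : ∀ K ⊆ A, ∀ M ⊆ B, IsCompact K → IsCompact M →
      ENNReal.ofReal a * volume K + ENNReal.ofReal b * volume M ≤ volume S := by
    intro K hKA M hMB hK hM
    refine le_trans ?_ (key (insert x K) (Set.insert_subset hx hKA) (insert y M)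
      (Set.insert_subset hy hMB) (hK.insert x) (hM.insert y) (Set.insert_nonempty _ _)
      (Set.insert_nonempty _ _))
    gcongr <;> exact Set.subset_insert _ _
  rw [hA.measure_eq_iSup_isCompact, hB.measure_eq_iSup_isCompact]
  simp only [ENNReal.mul_iSup, iSup_and']
  exact ENNReal.biSup_add_biSup_le' ⟨∅, Set.empty_subset _, isCompact_empty⟩
    ⟨∅, Set.empty_subset _, isCompact_empty⟩ fun K hK M hM => key2 K hK.1 M hM.1 hK.2 hM.2

lemma rpow_two_weights {a b α β I J k : ℝ} (ha : 0 < a) (hb : 0 < b) (hα : 0 < α) (hβ : 0 < β)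
    (hI : 0 < I) (hJ : 0 < J) (hk : 0 < k) :
    (a * α + b * β) ^ (k + 1) ≤ (a * α ^ (k + 1) * I + b * β ^ (k + 1) * J) *
      (a * I ^ (-1 / k) + b * J ^ (-1 / k)) ^ k := by
  set T := a * I ^ (-1 / k) + b * J ^ (-1 / k) with hT
  have hTp : 0 < T := by positivity
  have hc := (convexOn_rpow (p := k + 1) (by linarith)).2
    (show α * I ^ (1 / k) ∈ Set.Ici 0 by simp only [Set.mem_Ici]; positivity)
    (show β * J ^ (1 / k) ∈ Set.Ici 0 by simp only [Set.mem_Ici]; positivity)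
    (show 0 ≤ a * I ^ (-1 / k) / T by positivity) (show 0 ≤ b * J ^ (-1 / k) / T by positivity)
    (by rw [← add_div, ← hT]; field_simp)
  have e1 : ∀ {I : ℝ}, 0 < I → I ^ (-1 / k) * I ^ (1 / k) = 1 := by
    intro I hI
    rw [← Real.rpow_add hI]
    simp [neg_div]
  have e2 : ∀ {I : ℝ}, 0 < I → (I ^ (1 / k)) ^ (k + 1) * I ^ (-1 / k) = I := by
    intro I hI
    rw [← Real.rpow_mul hI.le, ← Real.rpow_add hI]
    have : 1 / k * (k + 1) + -1 / k = 1 := by field_simp; ring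
    rw [this, Real.rpow_one]
  simp only [smul_eq_mul] at hc
  rw [Real.mul_rpow hα.le (by positivity), Real.mul_rpow hβ.le (by positivity)] at hc
  have l1 : a * I ^ (-1 / k) / T * (α * I ^ (1 / k)) + b * J ^ (-1 / k) / T * (β * J ^ (1 / k)) =
      (a * α + b * β) / T := by
    have : ∀ a I' I'' α : ℝ, a * I' / T * (α * I'') = a * α * (I' * I'') / T := by intros; ring
    rw [this, this, e1 hI, e1 hJ]; ring
  have l2 : a * I ^ (-1 / k) / T * (α ^ (k + 1) * (I ^ (1 / k)) ^ (k + 1)) +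
      b * J ^ (-1 / k) / T * (β ^ (k + 1) * (J ^ (1 / k)) ^ (k + 1)) =
      (a * α ^ (k + 1) * I + b * β ^ (k + 1) * J) / T := by
    have : ∀ a I' I'' α : ℝ, a * I' / T * (α * I'') = a * α * (I'' * I') / T := by intros; ring
    rw [this, this, e2 hI, e2 hJ]; ring
  rw [l1, l2, Real.div_rpow (by positivity) hTp.le, Real.rpow_add hTp, Real.rpow_one,
    div_le_div_iff₀ (by positivity) hTp] at hc
  have := le_of_mul_le_mul_right (hc.trans_eq (by ring :
    _ = (a * α ^ (k + 1) * I + b * β ^ (k + 1) * J) * T ^ k * T)) hTp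
  exact this

lemma rpow_neg_antitone {x y : ℝ≥0∞} {κ : ℝ} (hκ : 0 < κ) (h : x ≤ y) : y ^ (-κ) ≤ x ^ (-κ) := by
  rw [ENNReal.rpow_neg, ENNReal.rpow_neg, ENNReal.inv_le_inv]
  gcongr

section
variable {φ ψ χ : ℝ → ℝ≥0∞} {a b k : ℝ}

lemma bbl_min_le {α β γ u v w : ℝ≥0∞} {κ A B : ℝ} (hA : 0 < A) (hκ : 0 < κ)
    (hα : α ≠ 0) (hα' : α ≠ ⊤) (hβ : β ≠ 0) (hβ' : β ≠ ⊤)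
    (hγ : γ = ENNReal.ofReal A * α + ENNReal.ofReal B * β)
    (hu : α ≤ u) (hv : β ≤ v) (hw : w ≤ ENNReal.ofReal A * u + ENNReal.ofReal B * v) :
    min (α ^ κ * u ^ (-κ)) (β ^ κ * v ^ (-κ)) ≤ γ ^ κ * w ^ (-κ) := by
  have hγ0 : γ ≠ 0 := by
    rw [hγ]; simp [hα, hA]
  have hγt : γ ≠ ⊤ := by
    rw [hγ]; finiteness
  have cancel : ∀ {α : ℝ≥0∞}, α ≠ 0 → α ≠ ⊤ → α ^ κ * α ^ (-κ) = 1 := by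
    intro α h0 ht
    rw [← ENNReal.rpow_add _ _ h0 ht]; simp
  have main : ∀ θ : ℝ≥0∞, θ ≠ 0 → u ≤ θ * α → v ≤ θ * β → θ ^ (-κ) ≤ γ ^ κ * w ^ (-κ) := by
    intro θ h0 h1 h2
    have h3 : w ≤ θ * γ := by
      refine hw.trans ?_
      calc _ ≤ ENNReal.ofReal A * (θ * α) + ENNReal.ofReal B * (θ * β) := by gcongr
        _ = _ := by rw [hγ]; ring
    have h4 : (θ * γ) ^ (-κ) ≤ w ^ (-κ) := rpow_neg_antitone hκ h3
    calc θ ^ (-κ) = γ ^ κ * (θ * γ) ^ (-κ) := by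
          rw [ENNReal.mul_rpow_of_ne_zero h0 hγ0, mul_left_comm, cancel hγ0 hγt, mul_one]
      _ ≤ _ := by gcongr
  have ex : ∀ {α u : ℝ≥0∞}, α ≠ 0 → α ≠ ⊤ → α ≤ u → ∃ θ : ℝ≥0∞, θ ≠ 0 ∧ u = θ * α ∧
      θ ^ (-κ) = α ^ κ * u ^ (-κ) := by
    intro α u h0 ht hu
    have h1 : u / α ≠ 0 := by
      simp only [ne_eq, ENNReal.div_eq_zero_iff, not_or]
      exact ⟨fun h => h0 (by simpa [h] using hu), ht⟩
    have h2 : u = u / α * α := (ENNReal.div_mul_cancel h0 ht).symm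
    refine ⟨u / α, h1, h2, ?_⟩
    nth_rw 2 [h2]
    rw [ENNReal.mul_rpow_of_ne_zero h1 h0, mul_left_comm, cancel h0 ht, mul_one]
  obtain ⟨θ₁, h01, hu1, he1⟩ := ex hα hα' hu
  obtain ⟨θ₂, h02, hu2, he2⟩ := ex hβ hβ' hv
  rcases le_total θ₁ θ₂ with h | h
  · refine (min_le_right _ _).trans ?_
    rw [← he2]
    exact main θ₂ h02 (hu1.trans_le (by gcongr)) hu2.le
  · refine (min_le_left _ _).trans ?_
    rw [← he1]
    exact main θ₁ h01 hu1.le (hu2.trans_le (by gcongr))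

lemma exists_lt_iInf_rpow {ι : Type*} {φ : ι → ℝ≥0∞} {κ : ℝ} (hκ : 0 < κ) (h0 : ⨅ x, φ x ≠ 0)
    (ht : ⨅ x, φ x ≠ ⊤) {t : ℝ≥0∞} (h1 : t < 1) :
    ∃ x, t < (⨅ x, φ x) ^ κ * φ x ^ (-κ) := by
  by_contra! hcon
  set α := ⨅ x, φ x
  have cancel : α ^ κ * α ^ (-κ) = 1 := by
    rw [← ENNReal.rpow_add _ _ h0 ht]; simp
  have hle : ∀ x, (t ^ (-1 / κ)) * α ≤ φ x := by
    intro x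
    have h := hcon x
    rcases eq_or_ne (φ x) ⊤ with hx | hx
    · simp [hx]
    have hφ0 : φ x ≠ 0 := fun h => h0 (by simpa [h] using iInf_le φ x)
    rcases eq_or_ne t 0 with rfl | ht0
    · exfalso
      simp only [nonpos_iff_eq_zero, mul_eq_zero, ENNReal.rpow_eq_zero_iff] at h
      rcases h with h | h <;> rcases h with h | h
      · exact h0 h.1
      · exact ht h.1
      · exact hφ0 h.1
      · exact hx h.1
    have h2 : (α ^ κ * φ x ^ (-κ)) ^ (1 / κ) ≤ t ^ (1 / κ) := by
      gcongr
    rw [ENNReal.mul_rpow_of_nonneg _ _ (by positivity), ← ENNReal.rpow_mul, ← ENNReal.rpow_mul,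
      show κ * (1 / κ) = 1 by field_simp, show -κ * (1 / κ) = -1 by field_simp, ENNReal.rpow_one,
      ENNReal.rpow_neg_one, ← div_eq_mul_inv, ENNReal.div_le_iff hφ0 hx] at h2
    calc t ^ (-1 / κ) * α ≤ t ^ (-1 / κ) * (t ^ (1 / κ) * φ x) := by gcongr
      _ = φ x := by
        rw [← mul_assoc, ← ENNReal.rpow_add _ _ ht0 h1.ne_top]
        simp [neg_div]
  have h3 : t ^ (-1 / κ) * α ≤ α := le_iInf hle
  have h4 : 1 < t ^ (-1 / κ) := by
    rcases eq_or_ne t 0 with rfl | ht0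
    · rw [ENNReal.zero_rpow_of_neg (by rw [neg_div]; simp [hκ])]; simp
    rw [neg_div, ENNReal.rpow_neg, ENNReal.one_lt_inv]
    exact ENNReal.rpow_lt_one h1 (by positivity)
  have h5 : t ^ (-1 / κ) ≤ 1 := by
    rw [← ENNReal.mul_le_mul_iff_left h0 ht]; simpa using h3
  exact absurd h4 (not_lt.mpr h5)

lemma lintegral_eq_lintegral_meas_lt_of_le_one {F : ℝ → ℝ≥0∞} (hF : Measurable F)
    (h1 : ∀ x, F x ≤ 1) :
    ∫⁻ x, F x = ∫⁻ t in Set.Ioo (0 : ℝ) 1, volume {x | ENNReal.ofReal t < F x} := by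
  have hne : ∀ x, F x ≠ ⊤ := fun x => ne_top_of_le_ne_top (by simp) (h1 x)
  have h := lintegral_eq_lintegral_meas_lt volume (f := fun x => (F x).toReal)
    (Filter.Eventually.of_forall fun x => by simp) hF.ennreal_toReal.aemeasurable
  simp only [ENNReal.ofReal_toReal (hne _)] at h
  rw [h, ← lintegral_indicator measurableSet_Ioi, ← lintegral_indicator measurableSet_Ioo]
  apply lintegral_congr
  intro t
  simp only [Set.indicator_apply, Set.mem_Ioi, Set.mem_Ioo]
  by_cases ht : 0 < t
  · have : {x | t < (F x).toReal} = {x | ENNReal.ofReal t < F x} := by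
      ext x; simp [ENNReal.ofReal_lt_iff_lt_toReal ht.le (hne x)]
    simp only [ht, true_and, if_true, this]
    split_ifs with h2
    · rfl
    · rw [measure_eq_zero_iff_ae_notMem.2]
      filter_upwards with x
      simp only [not_lt]
      exact (h1 x).trans (by simpa using not_lt.1 h2)
  · simp [ht]

lemma bbl_real_weighted (hφ : Measurable φ) (hψ : Measurable ψ) (hχ : Measurable χ)
    (ha : 0 < a) (hb : 0 < b) {κ : ℝ} (hκ : 0 < κ)
    (h : ∀ x y, χ (a * x + b * y) ≤ ENNReal.ofReal a * φ x + ENNReal.ofReal b * ψ y)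
    (h0 : ⨅ x, φ x ≠ 0) (ht : ⨅ x, φ x ≠ ⊤) (h0' : ⨅ x, ψ x ≠ 0) (ht' : ⨅ x, ψ x ≠ ⊤) :
    ENNReal.ofReal a * ((⨅ x, φ x) ^ κ * ∫⁻ x, φ x ^ (-κ)) +
      ENNReal.ofReal b * ((⨅ x, ψ x) ^ κ * ∫⁻ x, ψ x ^ (-κ)) ≤
    (ENNReal.ofReal a * (⨅ x, φ x) + ENNReal.ofReal b * (⨅ x, ψ x)) ^ κ * ∫⁻ x, χ x ^ (-κ) := by
  set α := ⨅ x, φ x with hα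
  set β := ⨅ x, ψ x with hβ
  set γ := ENNReal.ofReal a * α + ENNReal.ofReal b * β with hγ
  have le1 : ∀ {α u : ℝ≥0∞}, α ≠ 0 → α ≠ ⊤ → α ≤ u → α ^ κ * u ^ (-κ) ≤ 1 := by
    intro α u h0 ht hu
    calc α ^ κ * u ^ (-κ) ≤ α ^ κ * α ^ (-κ) := by
          exact mul_le_mul_right (rpow_neg_antitone hκ hu) _
      _ = 1 := by rw [← ENNReal.rpow_add _ _ h0 ht]; simp
  set F : ℝ → ℝ≥0∞ := fun x => α ^ κ * φ x ^ (-κ) with hF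
  set G : ℝ → ℝ≥0∞ := fun x => β ^ κ * ψ x ^ (-κ) with hG
  set H : ℝ → ℝ≥0∞ := fun x => min (γ ^ κ * χ x ^ (-κ)) 1 with hH
  have mF : Measurable F := by fun_prop
  have mG : Measurable G := by fun_prop
  have mH : Measurable H := by fun_prop
  rw [← lintegral_const_mul (α ^ κ) (by fun_prop), ← lintegral_const_mul (β ^ κ) (by fun_prop),
    ← lintegral_const_mul (γ ^ κ) (by fun_prop)]
  have hFle : ∀ x, F x ≤ 1 := fun x => le1 h0 ht (iInf_le _ _)
  have hGle : ∀ x, G x ≤ 1 := fun x => le1 h0' ht' (iInf_le _ _)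
  calc _ = ENNReal.ofReal a * (∫⁻ x, F x) + ENNReal.ofReal b * (∫⁻ x, G x) := rfl
    _ ≤ ∫⁻ x, H x := by
      rw [lintegral_eq_lintegral_meas_lt_of_le_one mF hFle,
        lintegral_eq_lintegral_meas_lt_of_le_one mG hGle,
        lintegral_eq_lintegral_meas_lt_of_le_one mH fun x => min_le_right _ _,
        ← lintegral_const_mul' _ _ (by simp), ← lintegral_const_mul' _ _ (by simp),
        ← lintegral_add_left']
      · apply setLIntegral_mono' measurableSet_Ioo
        intro t htt
        apply volume_real_brunn_minkowski ha hb (measurableSet_lt (by fun_prop) mF)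
          (measurableSet_lt (by fun_prop) mG)
        · exact exists_lt_iInf_rpow hκ h0 ht (by simpa using htt.2)
        · exact exists_lt_iInf_rpow hκ h0' ht' (by simpa using htt.2)
        · intro x hx y hy
          simp only [Set.mem_ofPred_eq, hH, lt_min_iff] at hx hy ⊢
          refine ⟨(lt_min hx hy).trans_le (bbl_min_le ha hκ h0 ht h0' ht' hγ (iInf_le _ _)
            (iInf_le _ _) (h x y)), by simpa using htt.2⟩
      · refine (Measurable.const_mul ?_ _).aemeasurable
        have : Antitone fun t : ℝ => volume {x | ENNReal.ofReal t < F x} := by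
          intro s t hst
          apply measure_mono
          intro x hx
          exact lt_of_le_of_lt (ENNReal.ofReal_le_ofReal hst) hx
        exact this.measurable
    _ ≤ _ := lintegral_mono fun x => min_le_left _ _

end

lemma rpow_neg_div_le_of_weighted {α β I J X : ℝ≥0∞} {a b k : ℝ} (ha : 0 < a) (hb : 0 < b)
    (hk : 0 < k) (hα : α ≠ 0) (hα' : α ≠ ⊤) (hβ : β ≠ 0) (hβ' : β ≠ ⊤)
    (h : ENNReal.ofReal a * (α ^ (k + 1) * I) + ENNReal.ofReal b * (β ^ (k + 1) * J) ≤
      (ENNReal.ofReal a * α + ENNReal.ofReal b * β) ^ (k + 1) * X) :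
    X ^ (-1 / k) ≤ ENNReal.ofReal a * I ^ (-1 / k) + ENNReal.ofReal b * J ^ (-1 / k) := by
  have hk' : -1 / k < 0 := by rw [neg_div]; simp [hk]
  have ha0 : ENNReal.ofReal a ≠ 0 := by simp [ha]
  have hb0 : ENNReal.ofReal b ≠ 0 := by simp [hb]
  rcases eq_or_ne X ⊤ with rfl | hX
  · simp [ENNReal.top_rpow_of_neg hk']
  rcases eq_or_ne I 0 with rfl | hI
  · simp [ENNReal.zero_rpow_of_neg hk', ENNReal.mul_top ha0]
  rcases eq_or_ne J 0 with rfl | hJ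
  · simp [ENNReal.zero_rpow_of_neg hk', ENNReal.mul_top hb0]
  have hfin : (ENNReal.ofReal a * α + ENNReal.ofReal b * β) ^ (k + 1) * X ≠ ⊤ := by
    have : (ENNReal.ofReal a * α + ENNReal.ofReal b * β) ^ (k + 1) ≠ ⊤ :=
      ENNReal.rpow_ne_top_of_nonneg (by positivity) (by finiteness)
    finiteness
  have pw : ∀ {α : ℝ≥0∞}, α ≠ 0 → α ≠ ⊤ → α ^ (k + 1) ≠ 0 := fun h0 ht =>
    (ENNReal.rpow_pos (pos_iff_ne_zero.2 h0) ht).ne'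
  have hI' : I ≠ ⊤ := by
    rintro rfl
    rw [ENNReal.mul_top (pw hα hα'), ENNReal.mul_top ha0, top_add, top_le_iff] at h
    exact hfin h
  have hJ' : J ≠ ⊤ := by
    rintro rfl
    rw [ENNReal.mul_top (pw hβ hβ'), ENNReal.mul_top hb0, add_top, top_le_iff] at h
    exact hfin h
  have hX0 : X ≠ 0 := by
    rintro rfl
    simp only [mul_zero, nonpos_iff_eq_zero, add_eq_zero, mul_eq_zero] at h
    rcases h.1 with h | h | h
    exacts [ha0 h, pw hα hα' h, hI h]
  lift α to NNReal using hα'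
  lift β to NNReal using hβ'
  lift I to NNReal using hI'
  lift J to NNReal using hJ'
  lift X to NNReal using hX
  obtain ⟨a, rfl⟩ : ∃ a' : NNReal, a = a' := ⟨⟨a, ha.le⟩, rfl⟩
  obtain ⟨b, rfl⟩ : ∃ a' : NNReal, b = a' := ⟨⟨b, hb.le⟩, rfl⟩
  simp only [ENNReal.coe_ne_zero] at hα hβ hI hJ hX0
  simp only [ENNReal.ofReal_coe_nnreal] at h ⊢
  have hk1 : 0 ≤ k + 1 := by linarith
  rw [← ENNReal.coe_rpow_of_ne_zero hX0, ← ENNReal.coe_rpow_of_ne_zero hI,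
    ← ENNReal.coe_rpow_of_ne_zero hJ]
  rw [← ENNReal.coe_rpow_of_nonneg _ hk1, ← ENNReal.coe_rpow_of_nonneg _ hk1] at h
  norm_cast at h ⊢
  rw [← ENNReal.coe_rpow_of_nonneg _ hk1] at h
  norm_cast at h
  rw [← NNReal.coe_le_coe] at h ⊢
  push_cast at h ⊢
  have posn : ∀ {x : NNReal}, x ≠ 0 → (0 : ℝ) < x := fun h => NNReal.coe_pos.2 (pos_iff_ne_zero.2 h)
  have h1 := rpow_two_weights ha hb (posn hα) (posn hβ) (posn hI) (posn hJ) hk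
  have hα := posn hα
  have hβ := posn hβ
  have hI := posn hI
  have hJ := posn hJ
  have hX0 := posn hX0
  set T := (a : ℝ) * (I : ℝ) ^ (-1 / k) + b * (J : ℝ) ^ (-1 / k)
  have hT : 0 < T := by positivity
  set γ := (a : ℝ) * α + b * β
  have hγ : 0 < γ ^ (k + 1) := by positivity
  have h2 : γ ^ (k + 1) * 1 ≤ γ ^ (k + 1) * (X * T ^ k) := by
    calc γ ^ (k + 1) * 1 ≤ _ := (mul_one _).trans_le h1
      _ ≤ (γ ^ (k + 1) * X) * T ^ k := by
        gcongr
        refine le_trans (le_of_eq ?_) h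
        ring
      _ = _ := by ring
  have h3 : 1 ≤ X * T ^ k := le_of_mul_le_mul_left h2 hγ
  have h4 : (1 : ℝ) ≤ (X * T ^ k) ^ (1 / k) := Real.one_le_rpow h3 (by positivity)
  rw [Real.mul_rpow hX0.le (by positivity), ← Real.rpow_mul hT.le, mul_one_div_cancel hk.ne',
    Real.rpow_one] at h4
  rw [neg_div, Real.rpow_neg hX0.le]
  rw [inv_le_iff_one_le_mul₀ (by positivity)]
  linarith

/-- The one-dimensional Borell–Brascamp–Lieb inequality for negative exponents. -/
theorem bbl_real {φ ψ χ : ℝ → ℝ≥0∞} {a b k : ℝ} (hφ : Measurable φ) (hψ : Measurable ψ)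
    (hχ : Measurable χ) (ha : 0 < a) (hb : 0 < b) (hk : 0 < k)
    (h : ∀ x y, χ (a * x + b * y) ≤ ENNReal.ofReal a * φ x + ENNReal.ofReal b * ψ y) :
    (∫⁻ x, χ x ^ (-(k + 1))) ^ (-1 / k) ≤
      ENNReal.ofReal a * (∫⁻ x, φ x ^ (-(k + 1))) ^ (-1 / k) +
      ENNReal.ofReal b * (∫⁻ x, ψ x ^ (-(k + 1))) ^ (-1 / k) := by
  have hk' : -1 / k < 0 := by rw [neg_div]; simp [hk]
  have hk1 : 0 < k + 1 := by linarith
  let e : ℕ → ℝ≥0∞ := fun j => (j : ℝ≥0∞)⁻¹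
  have top_case : ∀ {φ : ℝ → ℝ≥0∞}, ⨅ x, φ x = ⊤ → (∫⁻ x, φ x ^ (-(k + 1))) ^ (-1 / k) = ⊤ := by
    intro φ h
    have : ∀ x, φ x = ⊤ := fun x => top_le_iff.1 (h ▸ iInf_le φ x)
    simp [this, ENNReal.top_rpow_of_neg (show -1 + -k < 0 by linarith),
      ENNReal.zero_rpow_of_neg hk']
  have step : ∀ j : ℕ, (∫⁻ x, χ x ^ (-(k + 1))) ^ (-1 / k) ≤
      ENNReal.ofReal a * (∫⁻ x, (φ x ⊔ e j) ^ (-(k + 1))) ^ (-1 / k) +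
      ENNReal.ofReal b * (∫⁻ x, (ψ x ⊔ e j) ^ (-(k + 1))) ^ (-1 / k) := by
    intro j
    have he : e j ≠ 0 := by simp [e]
    have inf_ne : ∀ φ : ℝ → ℝ≥0∞, ⨅ x, (φ x ⊔ e j) ≠ 0 := fun φ h =>
      he (nonpos_iff_eq_zero.1 (h ▸ le_iInf fun x => le_sup_right))
    by_cases h1 : ⨅ x, (φ x ⊔ e j) = ⊤
    · rw [top_case h1, ENNReal.mul_top (by simp [ha])]; simp
    by_cases h2 : ⨅ x, (ψ x ⊔ e j) = ⊤
    · rw [top_case h2, ENNReal.mul_top (by simp [hb])]; simp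
    refine rpow_neg_div_le_of_weighted ha hb hk (inf_ne _) h1 (inf_ne _) h2 ?_
    refine bbl_real_weighted (hφ.sup_const _) (hψ.sup_const _) hχ ha hb hk1 (fun x y => ?_)
      (inf_ne _) h1 (inf_ne _) h2
    exact (h x y).trans (by gcongr <;> exact le_sup_left)
  have lim : ∀ {φ : ℝ → ℝ≥0∞} (a : ℝ), Measurable φ → Filter.Tendsto
      (fun j => ENNReal.ofReal a * (∫⁻ x, (φ x ⊔ e j) ^ (-(k + 1))) ^ (-1 / k)) Filter.atTop
      (nhds (ENNReal.ofReal a * (∫⁻ x, φ x ^ (-(k + 1))) ^ (-1 / k))) := by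
    intro φ a hφ
    refine ENNReal.Tendsto.const_mul ?_ (Or.inr (by simp))
    refine (ENNReal.continuous_rpow_const.tendsto _).comp ?_
    refine lintegral_tendsto_of_tendsto_of_monotone (fun j => by fun_prop) ?_ ?_
    · filter_upwards with x i j hij
      refine rpow_neg_antitone hk1 (sup_le_sup_left ?_ _)
      simp only [e, ENNReal.inv_le_inv]
      exact_mod_cast hij
    · filter_upwards with x
      refine (ENNReal.continuous_rpow_const.tendsto _).comp ?_
      have := (tendsto_const_nhds (x := φ x)).max ENNReal.tendsto_inv_nat_nhds_zero
      simpa using this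
  exact ge_of_tendsto' ((lim a hφ).add (lim b hψ)) step

lemma lintegral_pi_succ {d : ℕ} {F : (Fin (d + 1) → ℝ) → ℝ≥0∞} (hF : Measurable F) :
    ∫⁻ z, F z = ∫⁻ z : Fin d → ℝ, ∫⁻ t : ℝ, F (Fin.cons t z) := by
  have h := (volume_preserving_piFinSuccAbove (fun _ : Fin (d + 1) => ℝ) 0).symm
  rw [← h.lintegral_comp hF, Measure.volume_eq_prod]
  refine (lintegral_prod_symm' (μ := (volume : Measure ℝ)) (ν := (volume : Measure (Fin d → ℝ)))
    (fun q => F ((MeasurableEquiv.piFinSuccAbove (fun _ : Fin (d + 1) => ℝ) 0).symm q))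
    (hF.comp h.measurable)).trans ?_
  simp [MeasurableEquiv.piFinSuccAbove, Fin.insertNthEquiv]

/-- The Borell–Brascamp–Lieb inequality for negative exponents. -/
theorem bbl_pi {d : ℕ} : ∀ {φ ψ χ : (Fin d → ℝ) → ℝ≥0∞} {a b m : ℝ}, Measurable φ →
    Measurable ψ → Measurable χ → 0 < a → 0 < b → 0 < m →
    (∀ x y, χ (a • x + b • y) ≤ ENNReal.ofReal a * φ x + ENNReal.ofReal b * ψ y) →
    (∫⁻ x, χ x ^ (-(m + d))) ^ (-1 / m) ≤
      ENNReal.ofReal a * (∫⁻ x, φ x ^ (-(m + d))) ^ (-1 / m) +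
      ENNReal.ofReal b * (∫⁻ x, ψ x ^ (-(m + d))) ^ (-1 / m) := by
  induction d with
  | zero =>
    intro φ ψ χ a b m _ _ _ _ _ hm h
    have h2 : ∀ φ : (Fin 0 → ℝ) → ℝ≥0∞, (∫⁻ x, φ x ^ (-(m + (0 : ℕ)))) ^ (-1 / m) = φ 0 := by
      intro φ
      have : (volume : Measure (Fin 0 → ℝ)) = Measure.dirac 0 := Measure.volume_pi_eq_dirac _
      rw [this, lintegral_dirac, ← ENNReal.rpow_mul]
      rw [show -(m + (0 : ℕ)) * (-1 / m) = 1 by field_simp; simp, ENNReal.rpow_one]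
    rw [h2, h2, h2]
    simpa using h 0 0
  | succ d ih =>
    intro φ ψ χ a b m hφ hψ hχ ha hb hm h
    have hmd : 0 < m + d := by positivity
    let marg : ((Fin (d + 1) → ℝ) → ℝ≥0∞) → (Fin d → ℝ) → ℝ≥0∞ := fun φ z =>
      (∫⁻ t : ℝ, φ (Fin.cons t z) ^ (-(m + d + 1))) ^ (-1 / (m + d))
    have hcons : Measurable fun q : (Fin d → ℝ) × ℝ => (Fin.cons q.2 q.1 : Fin (d + 1) → ℝ) := by
      refine measurable_pi_lambda _ fun i => ?_
      refine Fin.cases ?_ (fun i => ?_) i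
      · simpa using measurable_snd
      · simp only [Fin.cons_succ]
        exact (measurable_pi_apply i).comp measurable_fst
    have hmarg : ∀ {φ}, Measurable φ → Measurable (marg φ) := by
      intro φ hφ
      refine Measurable.pow_const ?_ _
      exact Measurable.lintegral_prod_right' (f := fun q : (Fin d → ℝ) × ℝ =>
        φ (Fin.cons q.2 q.1) ^ (-(m + d + 1))) ((hφ.comp hcons).pow_const _)
    have hint : ∀ {φ}, Measurable φ →
        ∫⁻ x, φ x ^ (-(m + (d + 1 : ℕ))) = ∫⁻ z, marg φ z ^ (-(m + d)) := by
      intro φ hφ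
      rw [lintegral_pi_succ (hφ.pow_const _)]
      refine lintegral_congr fun z => ?_
      simp only [marg]
      rw [← ENNReal.rpow_mul, show -1 / (m + d) * -(m + d) = 1 by field_simp, ENNReal.rpow_one]
      push_cast
      rw [add_assoc]
    rw [hint hφ, hint hψ, hint hχ]
    refine ih (hmarg hφ) (hmarg hψ) (hmarg hχ) ha hb hm fun x y => ?_
    have hc : ∀ z : Fin d → ℝ, Measurable fun t : ℝ => (Fin.cons t z : Fin (d + 1) → ℝ) :=
      fun z => hcons.comp measurable_prodMk_left
    refine bbl_real (hφ.comp (hc _)) (hψ.comp (hc _)) (hχ.comp (hc _)) ha hb hmd fun s t => ?_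
    convert h (Fin.cons s x) (Fin.cons t y) using 2
    ext i
    refine Fin.cases ?_ (fun i => ?_) i <;> simp

/-- `L` parametrises the hyperplane orthogonal to the unit vector `e`, and
`(z, t) ↦ L z + t • e` preserves the volume. -/
structure IsFrame {d : ℕ} (e : EuclideanSpace ℝ (Fin (d + 1)))
    (L : (Fin d → ℝ) →ₗ[ℝ] EuclideanSpace ℝ (Fin (d + 1))) : Prop where
  measurePreserving : MeasurePreserving (fun q : (Fin d → ℝ) × ℝ => L q.1 + q.2 • e)
    (volume.prod volume) volume
  inner_eq_zero : ∀ w, ⟪L w, e⟫ = 0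
  inner_self : ⟪e, e⟫ = 1

lemma IsFrame.exists {d : ℕ} {e : EuclideanSpace ℝ (Fin (d + 1))} (he : ‖e‖ = 1) :
    ∃ L, IsFrame e L := by
  obtain ⟨b, hb⟩ := Orthonormal.exists_orthonormalBasis_extension_of_card_eq (𝕜 := ℝ)
    (E := EuclideanSpace ℝ (Fin (d + 1))) (ι := Fin (d + 1)) (by simp) (v := fun _ => e)
    (s := {0}) (by
      rw [orthonormal_iff_ite]
      rintro ⟨i, rfl⟩ ⟨j, rfl⟩
      simp [he])
  have hb0 : b 0 = e := hb 0 rfl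
  refine ⟨∑ i : Fin d, (LinearMap.proj i).smulRight (b i.succ), ?_, fun w => ?_, by simp [he]⟩
  · have h1 := (volume_preserving_piFinSuccAbove (fun _ : Fin (d + 1) => ℝ) 0).symm
    have h2 := b.measurePreserving_repr_symm.comp
      ((PiLp.volume_preserving_toLp (Fin (d + 1))).comp (h1.comp Measure.measurePreserving_swap))
    convert h2 using 1
    ext1 q
    simp only [Function.comp_apply, ← b.sum_repr_symm]
    simp [Fin.sum_univ_succ, MeasurableEquiv.piFinSuccAbove, Fin.insertNthEquiv, hb0, add_comm]
  · simp only [LinearMap.coe_sum, Finset.sum_apply, LinearMap.smulRight_apply,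
      LinearMap.proj_apply, sum_inner, inner_smul_left]
    refine Finset.sum_eq_zero fun i _ => ?_
    rw [← hb0, b.inner_eq_zero (Fin.succ_ne_zero i), mul_zero]

lemma IsFrame.neg {d : ℕ} {e : EuclideanSpace ℝ (Fin (d + 1))}
    {L : (Fin d → ℝ) →ₗ[ℝ] EuclideanSpace ℝ (Fin (d + 1))} (h : IsFrame e L) :
    IsFrame (-e) L := by
  refine ⟨?_, by simp [h.inner_eq_zero], by simpa using h.inner_self⟩
  convert h.measurePreserving.comp
    ((MeasurePreserving.id (volume : Measure (Fin d → ℝ))).prod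
      (Measure.measurePreserving_neg (volume : Measure ℝ))) using 1
  ext1 q
  simp

lemma lintegral_Ioi_pow_indicator (d : ℕ) (T : ℝ≥0∞) :
    ∫⁻ t in Set.Ioi (0 : ℝ), ENNReal.ofReal t ^ d *
      {t : ℝ | ENNReal.ofReal t < T}.indicator 1 t = T ^ (d + 1) / (d + 1 : ℕ) := by
  have fin : ∀ r : ℝ, 0 ≤ r → ∫⁻ t in Set.Ioi (0 : ℝ), ENNReal.ofReal t ^ d *
      {t : ℝ | ENNReal.ofReal t < ENNReal.ofReal r}.indicator 1 t =
      ENNReal.ofReal r ^ (d + 1) / (d + 1 : ℕ) := by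
    intro r hr
    have h1 : ∫⁻ t in Set.Ioi (0 : ℝ), ENNReal.ofReal t ^ d *
        {t : ℝ | ENNReal.ofReal t < ENNReal.ofReal r}.indicator 1 t =
        ∫⁻ t in Set.Ioo (0 : ℝ) r, ENNReal.ofReal (t ^ d) := by
      rw [← lintegral_indicator measurableSet_Ioi, ← lintegral_indicator measurableSet_Ioo]
      refine lintegral_congr fun t => ?_
      by_cases h0 : 0 < t
      · by_cases h1 : t < r
        · simp [Set.indicator, h0, h1, ENNReal.ofReal_pow h0.le, h0.trans h1]
        · simp [Set.indicator, h1, ENNReal.ofReal_lt_ofReal_iff_of_nonneg h0.le]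
      · simp [Set.indicator, h0]
    rw [h1, ← setLIntegral_congr Ioo_ae_eq_Ioc.symm, ← ofReal_integral_eq_lintegral_ofReal]
    · rw [← intervalIntegral.integral_of_le hr, integral_pow,
        ENNReal.ofReal_div_of_pos (by positivity)]
      simp [ENNReal.ofReal_pow hr]
      norm_cast
    · have := (intervalIntegral.intervalIntegrable_pow (μ := volume) (a := 0) (b := r) d)
      exact (intervalIntegrable_iff_integrableOn_Ioc_of_le hr).1 this
    · filter_upwards [ae_restrict_mem measurableSet_Ioc] with t ht
      have := ht.1.le
      positivity
  rcases eq_or_ne T ⊤ with rfl | hT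
  · rw [ENNReal.top_pow (by simp), ENNReal.top_div_of_ne_top (by simp), ← top_le_iff]
    refine ENNReal.le_of_forall_nnreal_lt fun r _ => ?_
    have := fin (((d + 1 : ℕ) : ℝ) * r + 1) (by positivity)
    refine le_trans ?_ (this.symm.le.trans (lintegral_mono fun t => ?_))
    · rw [ENNReal.le_div_iff_mul_le (by simp) (by simp)]
      have h2 : (r : ℝ≥0∞) * (d + 1 : ℕ) ≤ ENNReal.ofReal (((d + 1 : ℕ) : ℝ) * r + 1) := by
        rw [show (r : ℝ≥0∞) * (d + 1 : ℕ) = ENNReal.ofReal (r * (d + 1 : ℕ)) by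
          rw [ENNReal.ofReal_mul (by simp)]; simp; norm_cast]
        apply ENNReal.ofReal_le_ofReal; linarith
      refine h2.trans (le_self_pow₀ ?_ (by simp))
      rw [ENNReal.one_le_ofReal]
      have : 0 ≤ ((d + 1 : ℕ) : ℝ) * r := by positivity
      linarith
    · refine mul_le_mul_right (Set.indicator_le_indicator_of_subset ?_ (fun _ => zero_le_one) t) _
      intro t _
      simp
  · simpa [ENNReal.ofReal_toReal hT] using fin T.toReal (by simp)

section
variable {d : ℕ} {e : EuclideanSpace ℝ (Fin (d + 1))}
  {L : (Fin d → ℝ) →ₗ[ℝ] EuclideanSpace ℝ (Fin (d + 1))}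

lemma lintegral_volume_slice_lt_one {h : EuclideanSpace ℝ (Fin (d + 1)) → ℝ≥0∞}
    (hh : Measurable h) (hom : ∀ s : ℝ, 0 < s → ∀ y, h (s • y) = ENNReal.ofReal s * h y) :
    ∫⁻ t in Set.Ioi (0 : ℝ), volume {w | h (L w + t • e) < 1} =
      (∫⁻ w, h (L w + e) ^ (-(1 + d : ℝ))) / (d + 1 : ℕ) := by
  have hL : Measurable L := L.continuous_of_finiteDimensional.measurable
  have hm : Measurable fun w => h (L w + e) := by fun_prop
  have slice : ∀ t ∈ Set.Ioi (0 : ℝ), volume {w | h (L w + t • e) < 1} =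
      ∫⁻ w, ENNReal.ofReal t ^ d *
        {t : ℝ | ENNReal.ofReal t < (h (L w + e))⁻¹}.indicator 1 t := by
    intro t ht
    have ht : 0 < t := ht
    have hset : {w | h (L w + t • e) < 1} = t • {w | ENNReal.ofReal t < (h (L w + e))⁻¹} := by
      ext w
      rw [Set.mem_smul_set_iff_inv_smul_mem₀ ht.ne', Set.mem_ofPred_eq, Set.mem_ofPred_eq,
        ← one_div, ENNReal.lt_div_iff_mul_lt (by simp) (by simp [ht]), ← hom t ht, map_smul,
        smul_add,
        smul_inv_smul₀ ht.ne']
    have hms : MeasurableSet {w | ENNReal.ofReal t < (h (L w + e))⁻¹} :=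
      measurableSet_lt measurable_const hm.inv
    rw [hset, Measure.addHaar_smul, lintegral_const_mul' _ _ (by finiteness)]
    congr 1
    · simp [abs_of_pos ht, ENNReal.ofReal_pow ht.le]
    · rw [← lintegral_indicator_one hms]
      rfl
  rw [setLIntegral_congr_fun measurableSet_Ioi slice, lintegral_lintegral_swap]
  · simp_rw [lintegral_Ioi_pow_indicator, div_eq_mul_inv]
    rw [lintegral_mul_const' _ _ (by simp)]
    congr 1
    refine lintegral_congr fun w => ?_
    rw [← ENNReal.rpow_natCast, ENNReal.inv_rpow, ENNReal.rpow_neg]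
    push_cast
    rw [add_comm (d : ℝ)]
  · refine Measurable.aemeasurable ?_
    refine Measurable.mul (by fun_prop) ?_
    have : MeasurableSet {q : ℝ × (Fin d → ℝ) | ENNReal.ofReal q.1 < (h (L q.2 + e))⁻¹} :=
      measurableSet_lt (by fun_prop) (hm.inv.comp measurable_snd)
    exact measurable_one.indicator this

/-- The volume of the unit ball of a positively homogeneous function, computed by means of its
values on the two hyperplanes at distance one from the origin that are orthogonal to `e`. -/
lemma IsFrame.volume_lt_one (hL : IsFrame e L) {h : EuclideanSpace ℝ (Fin (d + 1)) → ℝ≥0∞}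
    (hh : Measurable h) (hom : ∀ s : ℝ, 0 < s → ∀ y, h (s • y) = ENNReal.ofReal s * h y) :
    volume {y | h y < 1} = ((∫⁻ w, h (L w + e) ^ (-(1 + d : ℝ))) +
      ∫⁻ w, h (L w - e) ^ (-(1 + d : ℝ))) / (d + 1 : ℕ) := by
  have hms : MeasurableSet {y | h y < 1} := measurableSet_lt hh measurable_const
  rw [← hL.measurePreserving.measure_preimage hms.nullMeasurableSet,
    Measure.prod_apply_symm (hL.measurePreserving.measurable hms),
    ← lintegral_add_compl _ measurableSet_Ioi (A := Set.Ioi (0 : ℝ)), ← ENNReal.div_add_div_same]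
  congr 1
  · exact lintegral_volume_slice_lt_one hh hom
  · rw [Set.compl_Ioi, setLIntegral_congr Iio_ae_eq_Iic.symm]
    have := lintegral_volume_slice_lt_one (e := -e) (L := L) hh hom
    simp only [← sub_eq_add_neg] at this
    rw [← this]
    have h2 := (Measure.measurePreserving_neg (volume : Measure ℝ)).setLIntegral_comp_emb
      (MeasurableEquiv.neg ℝ).measurableEmbedding
      (fun t => volume {w | h (L w + t • e) < 1}) (Set.Ioi 0)
    simp only [Set.image_neg_eq_neg, Set.neg_Ioi, neg_zero] at h2
    simp only [smul_neg, ← neg_smul]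
    exact h2.symm
end

lemma ConvexOn.exists_lintegral_Ioo_le {W : ℝ → ℝ} (hW : ConvexOn ℝ Set.univ W)
    (hc : Continuous W) {A B : ℝ} (hA : AntitoneOn W (Set.Iic A))
    (hB : MonotoneOn W (Set.Ici B)) {g : ℝ → ℝ≥0∞} (hg : Measurable g) (hg1 : ∀ x, g x ≤ 1)
    {l : ℝ} (hl : 0 < l) (hgl : ∫⁻ x, g x = ENNReal.ofReal (2 * l)) :
    ∃ m, ∫⁻ x in Set.Ioo (m - l) (m + l), ENNReal.ofReal (W x) ≤
      ∫⁻ x, g x * ENNReal.ofReal (W x) := by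
  obtain ⟨m, hm⟩ : ∃ m, W (m + l) - W (m - l) = 0 := by
    refine mem_range_of_exists_le_of_exists_ge (by fun_prop) ⟨A - l, ?_⟩ ⟨B + l, ?_⟩
    · have := hA (a := A - l - l) (b := A - l + l) (by simp; linarith) (by simp) (by linarith)
      linarith
    · have := hB (a := B + l - l) (b := B + l + l) (by simp) (by simp; linarith) (by linarith)
      linarith
  refine ⟨m, ?_⟩
  set w := W (m + l) with hw
  have hw' : W (m - l) = w := by linarith
  have inside : ∀ x ∈ Set.Ioo (m - l) (m + l), W x ≤ w := fun x hx => by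
    have := hW.le_max_of_mem_Icc (Set.mem_univ _) (Set.mem_univ _) (Set.Ioo_subset_Icc_self hx)
    rwa [hw', max_self] at this
  have outside : ∀ x ∉ Set.Ioo (m - l) (m + l), w ≤ W x := fun x hx => by
    by_contra! hlt
    rw [Set.mem_Ioo, not_and_or, not_lt, not_lt] at hx
    rcases hx with hx | hx
    · rcases hx.eq_or_lt with rfl | hx
      · exact hlt.ne hw'
      have := hW.lt_right_of_left_lt (x := x) (y := m + l) (z := m - l) (Set.mem_univ _)
          (Set.mem_univ _)
        (by rw [openSegment_eq_Ioo (by linarith)]; constructor <;> linarith) (by linarith)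
      linarith
    · rcases hx.eq_or_lt with rfl | hx
      · exact hlt.ne rfl
      have := hW.lt_left_of_right_lt (x := m - l) (y := x) (z := m + l) (Set.mem_univ _)
          (Set.mem_univ _)
        (by rw [openSegment_eq_Ioo (by linarith)]; constructor <;> linarith) (by linarith)
      linarith
  set I := Set.Ioo (m - l) (m + l)
  have hI : MeasurableSet I := measurableSet_Ioo
  have hgW : Measurable fun x => g x * ENNReal.ofReal (W x) := by fun_prop
  have key : ∫⁻ x, (I.indicator (fun x => ENNReal.ofReal (W x)) x + g x * ENNReal.ofReal w) ≤
      ∫⁻ x, (g x * ENNReal.ofReal (W x) + I.indicator (fun _ => ENNReal.ofReal w) x) := by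
    refine lintegral_mono fun x => ?_
    by_cases hx : x ∈ I
    · simp only [Set.indicator_of_mem hx]
      obtain ⟨r, hr⟩ := exists_add_of_le (hg1 x)
      calc ENNReal.ofReal (W x) + g x * ENNReal.ofReal w
          = g x * ENNReal.ofReal (W x) + (r * ENNReal.ofReal (W x) + g x * ENNReal.ofReal w) := by
            rw [← add_assoc, ← add_mul, ← hr, one_mul]
        _ ≤ g x * ENNReal.ofReal (W x) + (r * ENNReal.ofReal w + g x * ENNReal.ofReal w) := by
            gcongr; exact inside x hx
        _ = _ := by rw [← add_mul, add_comm r, ← hr, one_mul]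
    · simp only [Set.indicator_of_notMem hx, zero_add, add_zero]
      gcongr
      exact outside x hx
  rw [lintegral_add_right _ (hg.mul_const _), lintegral_add_left hgW, lintegral_indicator hI,
    lintegral_indicator hI, lintegral_mul_const _ hg, hgl, setLIntegral_const, Real.volume_Ioo,
    show m + l - (m - l) = 2 * l by ring, mul_comm (ENNReal.ofReal w)] at key
  exact (ENNReal.add_le_add_iff_right (by finiteness)).1 key

lemma lintegral_Ioo_comp_neg (l : ℝ) (F : ℝ → ℝ≥0∞) :
    ∫⁻ x in Set.Ioo (-l) l, F (-x) = ∫⁻ x in Set.Ioo (-l) l, F x := by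
  have := (Measure.measurePreserving_neg (volume : Measure ℝ)).setLIntegral_comp_emb
    (MeasurableEquiv.neg ℝ).measurableEmbedding F (Set.Ioo (-l) l)
  simpa using this

lemma lintegral_Ioo_comp_add (m l : ℝ) (F : ℝ → ℝ≥0∞) :
    ∫⁻ x in Set.Ioo (-l) l, F (m + x) = ∫⁻ x in Set.Ioo (m - l) (m + l), F x := by
  have := (measurePreserving_add_left (volume : Measure ℝ) m).setLIntegral_comp_emb
    (MeasurableEquiv.addLeft m).measurableEmbedding F (Set.Ioo (-l) l)
  simpa [sub_eq_add_neg, add_comm] using this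

lemma convexOn_max_zero_rpow {p : ℝ} (hp : 1 ≤ p) :
    ConvexOn ℝ Set.univ fun x : ℝ => max x 0 ^ p := by
  have h1 : ConvexOn ℝ Set.univ fun x : ℝ => max x 0 :=
    (convexOn_id convex_univ).sup (convexOn_const 0 convex_univ)
  refine ConvexOn.comp (f := fun x : ℝ => max x 0) (g := fun x : ℝ => x ^ p) ?_ h1 ?_
  · refine (convexOn_rpow hp).subset ?_ ?_
    · rintro _ ⟨x, -, rfl⟩
      simp
    · have : (fun x : ℝ => max x 0) '' Set.univ = Set.Ici 0 := by
        ext y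
        constructor
        · rintro ⟨x, -, rfl⟩; simp
        · intro hy; exact ⟨y, trivial, max_eq_left hy⟩
      rw [this]
      exact convex_Ici 0
  · rintro _ ⟨x, -, rfl⟩ _ ⟨y, -, rfl⟩ h
    exact Real.rpow_le_rpow (by simp) h (by linarith)

lemma max_zero_rpow_weighted {p θ₁ θ₂ a b : ℝ} (hp : 1 ≤ p) (h1 : 0 < θ₁) (h2 : 0 < θ₂)
    (h12 : θ₁ + θ₂ = 1) :
    max ((a + b) / 2) 0 ^ p ≤
      θ₁ * (2 * θ₁) ^ (-p) * max a 0 ^ p + θ₂ * (2 * θ₂) ^ (-p) * max b 0 ^ p := by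
  have h := (convexOn_rpow hp).2 (x := max a 0 / (2 * θ₁)) (y := max b 0 / (2 * θ₂))
    (by simp only [Set.mem_Ici]; positivity) (by simp only [Set.mem_Ici]; positivity) h1.le h2.le
    h12
  simp only [smul_eq_mul] at h
  rw [Real.div_rpow (by positivity) (by positivity),
    Real.div_rpow (by positivity) (by positivity)] at h
  rw [Real.rpow_neg (by positivity), Real.rpow_neg (by positivity)]
  calc _ ≤ (θ₁ * (max a 0 / (2 * θ₁)) + θ₂ * (max b 0 / (2 * θ₂))) ^ p := by
        refine Real.rpow_le_rpow (by simp) ?_ (by linarith)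
        have e1 : θ₁ * (max a 0 / (2 * θ₁)) = max a 0 / 2 := by field_simp
        have e2 : θ₂ * (max b 0 / (2 * θ₂)) = max b 0 / 2 := by field_simp
        rw [e1, e2]
        have := le_max_left a 0
        have := le_max_left b 0
        have := le_max_right a 0
        have := le_max_right b 0
        exact max_le (by linarith) (by linarith)
    _ ≤ _ := h
    _ = _ := by ring

/-- The Steiner inequality for one-sided moments on a line. -/
lemma lintegral_Ioo_moment_le {p θ₁ θ₂ : ℝ} (hp : 1 ≤ p) (h1 : 0 < θ₁) (h2 : 0 < θ₂)
    (h12 : θ₁ + θ₂ = 1) (P Q : ℝ) {g : ℝ → ℝ≥0∞} (hg : Measurable g) (hg1 : ∀ x, g x ≤ 1)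
    {l : ℝ} (hgl : ∫⁻ x, g x = ENNReal.ofReal (2 * l)) :
    ∫⁻ t in Set.Ioo (-l) l, ENNReal.ofReal ((P + Q) / 2 + t) ^ p ≤
      ENNReal.ofReal (θ₁ * (2 * θ₁) ^ (-p)) * (∫⁻ t, g t * ENNReal.ofReal (P + t) ^ p) +
      ENNReal.ofReal (θ₂ * (2 * θ₂) ^ (-p)) * ∫⁻ t, g t * ENNReal.ofReal (Q - t) ^ p := by
  rcases le_or_gt l 0 with hl | hl
  · rw [Set.Ioo_eq_empty (by linarith)]; simp
  have hp0 : 0 ≤ p := by linarith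
  set κ₁ := θ₁ * (2 * θ₁) ^ (-p)
  set κ₂ := θ₂ * (2 * θ₂) ^ (-p)
  have hκ₁ : 0 ≤ κ₁ := by positivity
  have hκ₂ : 0 ≤ κ₂ := by positivity
  have hof : ∀ s : ℝ, ENNReal.ofReal s ^ p = ENNReal.ofReal (max s 0 ^ p) := fun s => by
    rw [← ENNReal.ofReal_rpow_of_nonneg (by simp) hp0]; simp
  let W : ℝ → ℝ := fun t => κ₁ * max (P + t) 0 ^ p + κ₂ * max (Q - t) 0 ^ p
  have hW : ConvexOn ℝ Set.univ W := by
    refine ConvexOn.add (ConvexOn.smul hκ₁ ?_) (ConvexOn.smul hκ₂ ?_)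
    · simpa [Function.comp_def, AffineMap.lineMap_apply, add_comm] using
        (convexOn_max_zero_rpow hp).comp_affineMap
        (AffineMap.lineMap (k := ℝ) P (P + 1))
    · simpa [Function.comp_def, AffineMap.lineMap_apply, add_comm, sub_eq_add_neg] using
        (convexOn_max_zero_rpow hp).comp_affineMap (AffineMap.lineMap (k := ℝ) Q (Q - 1))
  have hWc : Continuous W := by
    have : ∀ s : ℝ, s ≠ 0 ∨ 0 ≤ p := fun _ => Or.inr hp0
    fun_prop (disch := simp [hp0])
  have hA : AntitoneOn W (Set.Iic (-P)) := by
    intro x hx y hy hxy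
    simp only [Set.mem_Iic] at hx hy
    simp only [W]
    rw [max_eq_right (by linarith : P + x ≤ 0), max_eq_right (by linarith : P + y ≤ 0)]
    gcongr
  have hB : MonotoneOn W (Set.Ici Q) := by
    intro x hx y hy hxy
    simp only [Set.mem_Ici] at hx hy
    simp only [W]
    rw [max_eq_right (by linarith : Q - x ≤ 0), max_eq_right (by linarith : Q - y ≤ 0)]
    gcongr
  obtain ⟨m, hm⟩ := hW.exists_lintegral_Ioo_le hWc hA hB hg hg1 hl hgl
  have hWof : ∀ t, ENNReal.ofReal (W t) = ENNReal.ofReal κ₁ * ENNReal.ofReal (P + t) ^ p +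
      ENNReal.ofReal κ₂ * ENNReal.ofReal (Q - t) ^ p := fun t => by
    rw [hof, hof, ← ENNReal.ofReal_mul hκ₁, ← ENNReal.ofReal_mul hκ₂,
      ← ENNReal.ofReal_add (by positivity) (by positivity)]
  have hr : ∫⁻ x, g x * ENNReal.ofReal (W x) =
      ENNReal.ofReal κ₁ * (∫⁻ t, g t * ENNReal.ofReal (P + t) ^ p) +
      ENNReal.ofReal κ₂ * ∫⁻ t, g t * ENNReal.ofReal (Q - t) ^ p := by
    rw [← lintegral_const_mul _ (by fun_prop), ← lintegral_const_mul _ (by fun_prop),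
      ← lintegral_add_left (by fun_prop)]
    refine lintegral_congr fun t => ?_
    rw [hWof]
    ring
  rw [← hr]
  refine le_trans ?_ hm
  rw [← lintegral_Ioo_comp_add m l]
  simp only [hWof]
  rw [lintegral_add_left (by fun_prop), lintegral_const_mul _ (by fun_prop),
    lintegral_const_mul _ (by fun_prop),
    ← lintegral_Ioo_comp_neg l (fun x => ENNReal.ofReal (Q - (m + x)) ^ p),
    ← lintegral_const_mul _ (by fun_prop), ← lintegral_const_mul _ (by fun_prop),
    ← lintegral_add_left (by fun_prop)]
  refine lintegral_mono fun t => ?_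
  rw [hof, hof, hof, ← ENNReal.ofReal_mul hκ₁, ← ENNReal.ofReal_mul hκ₂,
      ← ENNReal.ofReal_add (by positivity) (by positivity)]
  refine ENNReal.ofReal_le_ofReal ?_
  convert max_zero_rpow_weighted hp h1 h2 h12 using 3
  ring

section
variable {d : ℕ} {e : EuclideanSpace ℝ (Fin (d + 1))}
  {L : (Fin d → ℝ) →ₗ[ℝ] EuclideanSpace ℝ (Fin (d + 1))} {p : ℝ}
  {f : EuclideanSpace ℝ (Fin (d + 1)) → ℝ≥0∞}

/-- The one-sided `p`-th moment of `f` in direction `y`. -/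
noncomputable def oneSidedMoment {n : ℕ} (p : ℝ) (f : EuclideanSpace ℝ (Fin n) → ℝ≥0∞)
    (y : EuclideanSpace ℝ (Fin n)) : ℝ≥0∞ := ∫⁻ x, f x * ENNReal.ofReal ⟪x, y⟫ ^ p

/-- The positively homogeneous function attached to the one-sided `p`-th moments. -/
noncomputable def momentGauge {n : ℕ} (p : ℝ) (f : EuclideanSpace ℝ (Fin n) → ℝ≥0∞)
    (y : EuclideanSpace ℝ (Fin n)) : ℝ≥0∞ := oneSidedMoment p f y ^ (1 / p)

/-- The volume of the unit ball of `momentGauge p f`. -/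
noncomputable def polarVolume {n : ℕ} (p : ℝ) (f : EuclideanSpace ℝ (Fin n) → ℝ≥0∞) : ℝ≥0∞ :=
  volume {y | momentGauge p f y < 1}

/-- Every line parallel to `e` is assigned the centred open interval whose length is the integral
of `f` over that line; `steiner e f` is the indicator function of the union. -/
noncomputable def steiner {n : ℕ} (e : EuclideanSpace ℝ (Fin n))
    (f : EuclideanSpace ℝ (Fin n) → ℝ≥0∞) (x : EuclideanSpace ℝ (Fin n)) : ℝ≥0∞ :=
  {x | ENNReal.ofReal (2 * |⟪x, e⟫|) < ∫⁻ t : ℝ, f (x + t • e)}.indicator 1 x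

lemma measurable_lineIntegral {n : ℕ} (e : EuclideanSpace ℝ (Fin n))
    {f : EuclideanSpace ℝ (Fin n) → ℝ≥0∞} (hf : Measurable f) :
    Measurable fun x => ∫⁻ t : ℝ, f (x + t • e) :=
  Measurable.lintegral_prod_right' (f := fun q : EuclideanSpace ℝ (Fin n) × ℝ =>
    f (q.1 + q.2 • e)) (by fun_prop)

lemma measurable_steiner {n : ℕ} (e : EuclideanSpace ℝ (Fin n))
    {f : EuclideanSpace ℝ (Fin n) → ℝ≥0∞} (hf : Measurable f) : Measurable (steiner e f) :=
  measurable_one.indicator (measurableSet_lt (by fun_prop) (measurable_lineIntegral e hf))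

lemma steiner_le_one {n : ℕ} (e : EuclideanSpace ℝ (Fin n))
    (f : EuclideanSpace ℝ (Fin n) → ℝ≥0∞) (x : EuclideanSpace ℝ (Fin n)) : steiner e f x ≤ 1 :=
  Set.indicator_le_self' (fun _ _ => zero_le) x

lemma measurable_oneSidedMoment {n : ℕ} {f : EuclideanSpace ℝ (Fin n) → ℝ≥0∞}
    (hf : Measurable f) : Measurable (oneSidedMoment p f) :=
  Measurable.lintegral_prod_right' (f := fun q : EuclideanSpace ℝ (Fin n) ×
    EuclideanSpace ℝ (Fin n) => f q.2 * ENNReal.ofReal ⟪q.2, q.1⟫ ^ p)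
    (by fun_prop)

lemma measurable_momentGauge {n : ℕ} {f : EuclideanSpace ℝ (Fin n) → ℝ≥0∞}
    (hf : Measurable f) : Measurable (momentGauge p f) :=
  (measurable_oneSidedMoment hf).pow_const _

lemma momentGauge_smul {n : ℕ} {f : EuclideanSpace ℝ (Fin n) → ℝ≥0∞} (hf : Measurable f)
    (hp : 0 < p) {s : ℝ} (hs : 0 < s) (y : EuclideanSpace ℝ (Fin n)) :
    momentGauge p f (s • y) = ENNReal.ofReal s * momentGauge p f y := by
  have : oneSidedMoment p f (s • y) = ENNReal.ofReal s ^ p * oneSidedMoment p f y := by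
    rw [oneSidedMoment, oneSidedMoment, ← lintegral_const_mul _ (by fun_prop)]
    refine lintegral_congr fun x => ?_
    rw [inner_smul_right, ENNReal.ofReal_mul hs.le, ENNReal.mul_rpow_of_nonneg _ _ hp.le]
    ring
  rw [momentGauge, this, ENNReal.mul_rpow_of_nonneg _ _ (by positivity), ← ENNReal.rpow_mul,
    mul_one_div_cancel hp.ne', ENNReal.rpow_one, momentGauge]

lemma IsFrame.lintegral_eq (hL : IsFrame e L) {F : EuclideanSpace ℝ (Fin (d + 1)) → ℝ≥0∞}
    (hF : Measurable F) : ∫⁻ x, F x = ∫⁻ z, ∫⁻ t : ℝ, F (L z + t • e) := by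
  rw [← hL.measurePreserving.lintegral_comp hF, lintegral_prod]
  exact (hF.comp hL.measurePreserving.measurable).aemeasurable

lemma lineIntegral_add_smul {n : ℕ} (e x : EuclideanSpace ℝ (Fin n))
    (f : EuclideanSpace ℝ (Fin n) → ℝ≥0∞) (s : ℝ) :
    ∫⁻ t : ℝ, f (x + s • e + t • e) = ∫⁻ t : ℝ, f (x + t • e) := by
  rw [← lintegral_add_left_eq_self (fun t : ℝ => f (x + t • e)) s]
  simp only [add_smul, add_assoc]

lemma steiner_neg {n : ℕ} (e : EuclideanSpace ℝ (Fin n))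
    (f : EuclideanSpace ℝ (Fin n) → ℝ≥0∞) : steiner (-e) f = steiner e f := by
  ext x
  have : ∀ x, ∫⁻ t : ℝ, f (x + t • -e) = ∫⁻ t : ℝ, f (x + t • e) := fun x => by
    rw [← lintegral_neg_eq_self (fun t : ℝ => f (x + t • e))]
    simp
  simp only [steiner, this, inner_neg_right, abs_neg]

lemma IsFrame.inner_add (hL : IsFrame e L) (z w : Fin d → ℝ) (t s : ℝ) :
    ⟪L z + t • e, L w + s • e⟫ = ⟪L z, L w⟫ + t * s := by
  have h2 : ⟪e, L w⟫ = 0 := by rw [real_inner_comm, hL.inner_eq_zero]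
  have h3 : ‖e‖ ^ 2 = 1 := by rw [← real_inner_self_eq_norm_sq, hL.inner_self]
  simp [inner_add_left, inner_add_right, inner_smul_left, inner_smul_right, hL.inner_eq_zero,
    h3, h2, mul_comm]

lemma IsFrame.steiner_apply (hL : IsFrame e L) (z : Fin d → ℝ) {l : ℝ}
    (hl : ∫⁻ t : ℝ, f (L z + t • e) = ENNReal.ofReal (2 * l)) (t : ℝ) :
    steiner e f (L z + t • e) = (Set.Ioo (-l) l).indicator 1 t := by
  have h1 : ⟪L z + t • e, e⟫ = t := by
    have := hL.inner_add z 0 t 1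
    simpa using this
  simp only [steiner, Set.indicator, Set.mem_ofPred_eq, h1, lineIntegral_add_smul, hl,
    ENNReal.ofReal_lt_ofReal_iff_of_nonneg (show 0 ≤ 2 * |t| by positivity), Set.mem_Ioo,
    ← abs_lt]
  simp

lemma IsFrame.oneSidedMoment_steiner_le (hL : IsFrame e L) (hp : 1 ≤ p) (hf : Measurable f)
    (hf1 : ∀ x, f x ≤ 1) (hfe : ∀ x, ∫⁻ t : ℝ, f (x + t • e) ≠ ⊤) {θ₁ θ₂ : ℝ} (h1 : 0 < θ₁)
    (h2 : 0 < θ₂) (h12 : θ₁ + θ₂ = 1) (u v : Fin d → ℝ) :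
    oneSidedMoment p (steiner e f) (L ((1 / 2 : ℝ) • u + (1 / 2 : ℝ) • v) + e) ≤
      ENNReal.ofReal (θ₁ * (2 * θ₁) ^ (-p)) * oneSidedMoment p f (L u + e) +
      ENNReal.ofReal (θ₂ * (2 * θ₂) ^ (-p)) * oneSidedMoment p f (L v - e) := by
  have hS := measurable_steiner e hf
  have hLm : Measurable L := L.continuous_of_finiteDimensional.measurable
  have meas : ∀ y, Measurable fun z => ∫⁻ t : ℝ, f (L z + t • e) *
      ENNReal.ofReal ⟪L z + t • e, y⟫ ^ p := fun y =>
    Measurable.lintegral_prod_right' (f := fun q : (Fin d → ℝ) × ℝ =>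
      f (L q.1 + q.2 • e) * ENNReal.ofReal ⟪L q.1 + q.2 • e, y⟫ ^ p) (by fun_prop)
  simp only [oneSidedMoment]
  rw [hL.lintegral_eq (by fun_prop), hL.lintegral_eq (by fun_prop), hL.lintegral_eq (by fun_prop),
    ← lintegral_const_mul _ (meas _), ← lintegral_const_mul _ (meas _),
    ← lintegral_add_left ((meas _).const_mul _)]
  refine lintegral_mono fun z => ?_
  set l := (∫⁻ t : ℝ, f (L z + t • e)).toReal / 2
  have hl : ∫⁻ t : ℝ, f (L z + t • e) = ENNReal.ofReal (2 * l) := by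
    rw [mul_div_cancel₀ _ (by norm_num), ENNReal.ofReal_toReal (hfe _)]
  have key := lintegral_Ioo_moment_le hp h1 h2 h12 ⟪L z, L u⟫ ⟪L z, L v⟫
    (g := fun t => f (L z + t • e)) (by fun_prop) (fun t => hf1 _) hl
  have i1 : ∀ w t, ⟪L z + t • e, L w + e⟫ = ⟪L z, L w⟫ + t := fun w t => by
    simpa using hL.inner_add z w t 1
  have i2 : ∀ w t, ⟪L z + t • e, L w - e⟫ = ⟪L z, L w⟫ - t := fun w t => by
    simpa [sub_eq_add_neg] using hL.inner_add z w t (-1)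
  simp only [i1, i2, hL.steiner_apply z hl]
  refine le_trans (le_of_eq ?_) key
  rw [← lintegral_indicator measurableSet_Ioo]
  refine lintegral_congr fun t => ?_
  by_cases ht : t ∈ Set.Ioo (-l) l
  · simp only [Set.indicator_of_mem ht, Pi.one_apply, one_mul, map_add, map_smul, inner_add_right,
      inner_smul_right]
    congr 2
    ring
  · simp [Set.indicator_of_notMem ht]

lemma rpow_inv_le_of_forall_weights {X Y A : ℝ≥0∞} (hp : 1 ≤ p)
    (h : ∀ θ₁ θ₂ : ℝ, 0 < θ₁ → 0 < θ₂ → θ₁ + θ₂ = 1 → A ≤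
      ENNReal.ofReal (θ₁ * (2 * θ₁) ^ (-p)) * X + ENNReal.ofReal (θ₂ * (2 * θ₂) ^ (-p)) * Y) :
    A ^ (1 / p) ≤ ENNReal.ofReal (1 / 2) * X ^ (1 / p) + ENNReal.ofReal (1 / 2) * Y ^ (1 / p) := by
  have hp0 : 0 < p := by linarith
  have half : ENNReal.ofReal (1 / 2) ≠ 0 := by simp
  obtain ⟨x, rfl⟩ : ∃ x, X = x ^ p := ⟨X ^ (1 / p), by
    rw [← ENNReal.rpow_mul, one_div_mul_cancel hp0.ne', ENNReal.rpow_one]⟩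
  obtain ⟨y, rfl⟩ : ∃ x, Y = x ^ p := ⟨Y ^ (1 / p), by
    rw [← ENNReal.rpow_mul, one_div_mul_cancel hp0.ne', ENNReal.rpow_one]⟩
  simp only [← ENNReal.rpow_mul, mul_one_div_cancel hp0.ne', ENNReal.rpow_one]
  rcases eq_or_ne x ⊤ with rfl | hx
  · rw [ENNReal.mul_top half]; simp
  rcases eq_or_ne y ⊤ with rfl | hy
  · rw [ENNReal.mul_top half]; simp
  lift x to NNReal using hx
  lift y to NNReal using hy
  refine ENNReal.le_of_forall_pos_le_add fun ε hε _ => ?_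
  have hx : (0 : ℝ) < x + ε := by positivity
  have hy : (0 : ℝ) < y + ε := by positivity
  set a : ℝ := x + ε
  set b : ℝ := y + ε
  have hs : 0 < a + b := by positivity
  have h1 := h (a / (a + b)) (b / (a + b)) (by positivity) (by positivity) (by field_simp)
  have eq1 : ∀ c : ℝ, 0 < c → c / (a + b) * (2 * (c / (a + b))) ^ (-p) * c ^ p =
      c / (a + b) * ((a + b) / 2) ^ p := by
    intro c hc
    rw [show 2 * (c / (a + b)) = c / ((a + b) / 2) by field_simp,
      Real.div_rpow hc.le (by positivity), Real.rpow_neg hc.le, Real.rpow_neg (by positivity)]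
    have : c ^ p ≠ 0 := by positivity
    field_simp
  have h2 : A ≤ ENNReal.ofReal ((a + b) / 2) ^ p := by
    refine h1.trans ?_
    have hxa : (x : ℝ≥0∞) ≤ ENNReal.ofReal a := by
      rw [← ENNReal.ofReal_coe_nnreal]; exact ENNReal.ofReal_le_ofReal (by simp [a])
    have hyb : (y : ℝ≥0∞) ≤ ENNReal.ofReal b := by
      rw [← ENNReal.ofReal_coe_nnreal]; exact ENNReal.ofReal_le_ofReal (by simp [b])
    calc _ ≤ ENNReal.ofReal (a / (a + b) * (2 * (a / (a + b))) ^ (-p)) * ENNReal.ofReal a ^ p +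
          ENNReal.ofReal (b / (a + b) * (2 * (b / (a + b))) ^ (-p)) * ENNReal.ofReal b ^ p := by
          gcongr
      _ = ENNReal.ofReal ((a + b) / 2) ^ p := by
          rw [ENNReal.ofReal_rpow_of_pos hx, ENNReal.ofReal_rpow_of_pos hy,
            ENNReal.ofReal_rpow_of_pos (by positivity), ← ENNReal.ofReal_mul (by positivity),
            ← ENNReal.ofReal_mul (by positivity),
            ← ENNReal.ofReal_add (by positivity) (by positivity),
            eq1 a hx, eq1 b hy]
          congr 1
          field_simp
  calc A ^ (1 / p) ≤ (ENNReal.ofReal ((a + b) / 2) ^ p) ^ (1 / p) := by gcongr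
    _ = ENNReal.ofReal ((a + b) / 2) := by
        rw [← ENNReal.rpow_mul, mul_one_div_cancel hp0.ne', ENNReal.rpow_one]
    _ = _ := by
        rw [← ENNReal.ofReal_coe_nnreal, ← ENNReal.ofReal_coe_nnreal, ← ENNReal.ofReal_coe_nnreal,
          ← ENNReal.ofReal_mul (by norm_num), ← ENNReal.ofReal_mul (by norm_num),
          ← ENNReal.ofReal_add (by positivity) (by positivity),
          ← ENNReal.ofReal_add (by positivity) (by positivity)]
        congr 1
        simp only [a, b]
        ring

lemma IsFrame.momentGauge_steiner_le (hL : IsFrame e L) (hp : 1 ≤ p) (hf : Measurable f)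
    (hf1 : ∀ x, f x ≤ 1) (hfe : ∀ x, ∫⁻ t : ℝ, f (x + t • e) ≠ ⊤) (u v : Fin d → ℝ) :
    momentGauge p (steiner e f) (L ((1 / 2 : ℝ) • u + (1 / 2 : ℝ) • v) + e) ≤
      ENNReal.ofReal (1 / 2) * momentGauge p f (L u + e) +
      ENNReal.ofReal (1 / 2) * momentGauge p f (L v - e) :=
  rpow_inv_le_of_forall_weights hp fun _ _ h1 h2 h12 =>
    hL.oneSidedMoment_steiner_le hp hf hf1 hfe h1 h2 h12 u v

/-- If both halves of the polar body cut out by the hyperplane orthogonal to `e` have the same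
volume, then `steiner e` does not decrease the polar volume. -/
lemma IsFrame.polarVolume_le_steiner (hL : IsFrame e L) (hp : 1 ≤ p) (hf : Measurable f)
    (hf1 : ∀ x, f x ≤ 1) (hfe : ∀ x, ∫⁻ t : ℝ, f (x + t • e) ≠ ⊤)
    (hbal : ∫⁻ w, momentGauge p f (L w + e) ^ (-(1 + d : ℝ)) =
      ∫⁻ w, momentGauge p f (L w - e) ^ (-(1 + d : ℝ))) :
    polarVolume p f ≤ polarVolume p (steiner e f) := by
  have hp0 : 0 < p := by linarith
  have hLm : Measurable L := L.continuous_of_finiteDimensional.measurable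
  have hG := measurable_momentGauge (p := p) hf
  have hGS := measurable_momentGauge (p := p) (measurable_steiner e hf)
  rw [polarVolume, polarVolume, hL.volume_lt_one hG (fun s hs => momentGauge_smul hf hp0 hs),
    hL.volume_lt_one hGS (fun s hs => momentGauge_smul (measurable_steiner e hf) hp0 hs)]
  have half : ∀ x : ℝ≥0∞, ENNReal.ofReal (1 / 2) * x + ENNReal.ofReal (1 / 2) * x = x := fun x => by
    rw [← add_mul, ← ENNReal.ofReal_add (by norm_num) (by norm_num)]
    norm_num
  have inv_le : ∀ {x y : ℝ≥0∞}, y ^ (-1 / (1 : ℝ)) ≤ x ^ (-1 / (1 : ℝ)) → x ≤ y := fun h => by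
    simpa [ENNReal.rpow_neg_one] using h
  refine ENNReal.div_le_div_right (add_le_add (inv_le ?_) (inv_le ?_)) _
  · have h1 := bbl_pi (d := d) (m := 1) (a := 1 / 2) (b := 1 / 2)
      (φ := fun w => momentGauge p f (L w + e)) (ψ := fun w => momentGauge p f (L w - e))
      (χ := fun w => momentGauge p (steiner e f) (L w + e)) (by fun_prop) (by fun_prop)
      (by fun_prop) (by norm_num) (by norm_num) (by norm_num)
      (fun u v => hL.momentGauge_steiner_le hp hf hf1 hfe u v)
    rwa [← hbal, half] at h1
  · have h1 := bbl_pi (d := d) (m := 1) (a := 1 / 2) (b := 1 / 2)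
      (φ := fun w => momentGauge p f (L w - e)) (ψ := fun w => momentGauge p f (L w + e))
      (χ := fun w => momentGauge p (steiner e f) (L w - e)) (by fun_prop) (by fun_prop)
      (by fun_prop) (by norm_num) (by norm_num) (by norm_num)
      (fun u v => by
        have := hL.neg.momentGauge_steiner_le hp hf hf1 (fun x => by
          rw [← lintegral_neg_eq_self (fun t : ℝ => f (x + t • -e))]
          simpa using hfe x) u v
        simpa [steiner_neg, ← sub_eq_add_neg] using this)
    rwa [hbal, half] at h1
end

section
variable {d : ℕ} {e : EuclideanSpace ℝ (Fin (d + 1))}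
  {L : (Fin d → ℝ) →ₗ[ℝ] EuclideanSpace ℝ (Fin (d + 1))} {p : ℝ}
  {f : EuclideanSpace ℝ (Fin (d + 1)) → ℝ≥0∞}

/-- `momentGauge p (fun x => f (x + τ • e)) (L w + e)`, after a change of variables. -/
noncomputable def shiftedGauge (p : ℝ) (f : EuclideanSpace ℝ (Fin (d + 1)) → ℝ≥0∞)
    (e : EuclideanSpace ℝ (Fin (d + 1))) (L : (Fin d → ℝ) →ₗ[ℝ] EuclideanSpace ℝ (Fin (d + 1)))
    (τ : ℝ) (w : Fin d → ℝ) : ℝ≥0∞ :=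
  (∫⁻ x, f x * ENNReal.ofReal (⟪x, L w + e⟫ - τ) ^ p) ^ (1 / p)

lemma IsFrame.momentGauge_translate (hL : IsFrame e L) (τ : ℝ) (w : Fin d → ℝ) :
    momentGauge p (fun x => f (x + τ • e)) (L w + e) = shiftedGauge p f e L τ w := by
  rw [momentGauge, oneSidedMoment, shiftedGauge]
  congr 1
  rw [← lintegral_add_right_eq_self (fun x => f x * ENNReal.ofReal (⟪x, L w + e⟫ - τ) ^ p) (τ • e)]
  refine lintegral_congr fun x => ?_
  have := hL.inner_add 0 w τ 1
  simp only [map_zero, zero_add, one_smul, inner_zero_left, mul_one] at this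
  rw [inner_add_left, this]
  simp

lemma measurable_shiftedGauge (hf : Measurable f) (τ : ℝ) :
    Measurable (shiftedGauge p f e L τ) := by
  have hLm : Measurable L := L.continuous_of_finiteDimensional.measurable
  refine Measurable.pow_const ?_ _
  exact Measurable.lintegral_prod_right' (f := fun q : (Fin d → ℝ) ×
    EuclideanSpace ℝ (Fin (d + 1)) => f q.2 * ENNReal.ofReal (⟪q.2, L q.1 + e⟫ - τ) ^ p)
    (by fun_prop)

lemma shiftedGauge_convex (hp : 1 ≤ p) (hf : Measurable f) {a b : ℝ} (ha : 0 < a) (hb : 0 < b)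
    (hab : a + b = 1) (σ τ : ℝ) (u v : Fin d → ℝ) :
    shiftedGauge p f e L (a * σ + b * τ) (a • u + b • v) ≤
      ENNReal.ofReal a * shiftedGauge p f e L σ u +
      ENNReal.ofReal b * shiftedGauge p f e L τ v := by
  have hp0 : 0 < p := by linarith
  have h := ENNReal.lintegral_Lp_add_le
      (μ := (volume : Measure (EuclideanSpace ℝ (Fin (d + 1)))).withDensity f)
    (f := fun x => ENNReal.ofReal a * ENNReal.ofReal (⟪x, L u + e⟫ - σ))
    (g := fun x => ENNReal.ofReal b * ENNReal.ofReal (⟪x, L v + e⟫ - τ)) (by fun_prop)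
    (by fun_prop) hp
  rw [lintegral_withDensity_eq_lintegral_mul _ hf (by simp only [Pi.add_apply]; fun_prop),
    lintegral_withDensity_eq_lintegral_mul _ hf (by fun_prop),
    lintegral_withDensity_eq_lintegral_mul _ hf (by fun_prop)] at h
  have pull : ∀ (c s : ℝ) (y), (∫⁻ x, (f * fun x => (ENNReal.ofReal c *
      ENNReal.ofReal (⟪x, y⟫ - s)) ^ p) x) ^ (1 / p) = ENNReal.ofReal c *
      (∫⁻ x, f x * ENNReal.ofReal (⟪x, y⟫ - s) ^ p) ^ (1 / p) := by
    intro c s y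
    have : ∀ x, (f * fun x => (ENNReal.ofReal c * ENNReal.ofReal (⟪x, y⟫ - s)) ^ p) x =
        ENNReal.ofReal c ^ p * (f x * ENNReal.ofReal (⟪x, y⟫ - s) ^ p) := by
      intro x
      rw [Pi.mul_apply, ENNReal.mul_rpow_of_nonneg _ _ hp0.le]
      ring
    simp only [this]
    rw [lintegral_const_mul _ (by fun_prop), ENNReal.mul_rpow_of_nonneg _ _ (by positivity),
      ← ENNReal.rpow_mul, mul_one_div_cancel hp0.ne', ENNReal.rpow_one]
  rw [pull, pull] at h
  refine le_trans ?_ h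
  rw [shiftedGauge]
  gcongr with x
  simp only [Pi.mul_apply, Pi.add_apply]
  gcongr
  rw [← ENNReal.ofReal_mul ha.le, ← ENNReal.ofReal_mul hb.le]
  refine le_trans (le_of_eq ?_) ENNReal.ofReal_add_le
  congr 1
  have hx : ⟪x, e⟫ = a * ⟪x, e⟫ + b * ⟪x, e⟫ := by rw [← add_mul, hab, one_mul]
  simp only [map_add, map_smul, inner_add_right, inner_smul_right]
  linear_combination hx

/-- The reciprocal of the volume (up to a constant) of one half of the polar body of
`f (· + τ • e)`. -/
noncomputable def halfPolarInv (p : ℝ) (f : EuclideanSpace ℝ (Fin (d + 1)) → ℝ≥0∞)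
    (e : EuclideanSpace ℝ (Fin (d + 1))) (L : (Fin d → ℝ) →ₗ[ℝ] EuclideanSpace ℝ (Fin (d + 1)))
    (τ : ℝ) : ℝ≥0∞ := (∫⁻ w, shiftedGauge p f e L τ w ^ (-(1 + d : ℝ)))⁻¹

lemma halfPolarInv_convex (hp : 1 ≤ p) (hf : Measurable f) {a b : ℝ} (ha : 0 < a) (hb : 0 < b)
    (hab : a + b = 1) (σ τ : ℝ) :
    halfPolarInv p f e L (a * σ + b * τ) ≤
      ENNReal.ofReal a * halfPolarInv p f e L σ + ENNReal.ofReal b * halfPolarInv p f e L τ := by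
  have := bbl_pi (d := d) (m := 1) (measurable_shiftedGauge (p := p) (e := e) (L := L) hf σ)
    (measurable_shiftedGauge (p := p) (e := e) (L := L) hf τ)
    (measurable_shiftedGauge (p := p) (e := e) (L := L) hf (a * σ + b * τ)) ha hb one_pos
    (shiftedGauge_convex hp hf ha hb hab σ τ)
  simpa only [halfPolarInv, div_one, ENNReal.rpow_neg_one] using this

variable {R : ℝ}

lemma shiftedGauge_ne_top (hp : 1 ≤ p) (hf1 : ∀ x, f x ≤ 1)
    (hR : ∀ x, f x ≠ 0 → ‖x‖ ≤ R) (τ : ℝ) (w : Fin d → ℝ) :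
    shiftedGauge p f e L τ w ≠ ⊤ := by
  have hp0 : 0 < p := by linarith
  refine ENNReal.rpow_ne_top_of_nonneg (by positivity) ?_
  have : ∫⁻ x, f x * ENNReal.ofReal (⟪x, L w + e⟫ - τ) ^ p ≤
      ∫⁻ x in Metric.closedBall (0 : EuclideanSpace ℝ (Fin (d + 1))) R,
        ENNReal.ofReal (R * ‖L w + e‖ - τ) ^ p := by
    rw [← lintegral_indicator Metric.isClosed_closedBall.measurableSet]
    refine lintegral_mono fun x => ?_
    by_cases hx : f x = 0
    · simp [hx]
    · have hxR := hR x hx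
      rw [Set.indicator_of_mem (by simpa using hxR)]
      calc _ ≤ 1 * ENNReal.ofReal (R * ‖L w + e‖ - τ) ^ p := by
            gcongr
            · exact hf1 x
            · exact (real_inner_le_norm _ _).trans (by gcongr)
        _ = _ := one_mul _
  refine ne_top_of_le_ne_top ?_ this
  rw [setLIntegral_const]
  have h1 : ENNReal.ofReal (R * ‖L w + e‖ - τ) ^ p ≠ ⊤ :=
    ENNReal.rpow_ne_top_of_nonneg hp0.le (by simp)
  exact ENNReal.mul_ne_top h1 measure_closedBall_lt_top.ne

lemma halfPolarInv_ne_top (hp : 1 ≤ p) (hf : Measurable f) (hf1 : ∀ x, f x ≤ 1)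
    (hR : ∀ x, f x ≠ 0 → ‖x‖ ≤ R) (τ : ℝ) : halfPolarInv p f e L τ ≠ ⊤ := by
  rw [halfPolarInv, Ne, ENNReal.inv_eq_top, lintegral_eq_zero_iff
    ((measurable_shiftedGauge hf τ).pow_const _)]
  intro h
  obtain ⟨w, hw⟩ := h.exists
  have hd : (0 : ℝ) < 1 + d := by positivity
  simp only [Pi.zero_apply, ENNReal.rpow_neg, ENNReal.inv_eq_zero,
    ENNReal.rpow_eq_top_iff_of_pos hd] at hw
  exact shiftedGauge_ne_top hp hf1 hR τ w hw

lemma IsFrame.norm_eq_one (hL : IsFrame e L) : ‖e‖ = 1 := by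
  have := hL.inner_self
  rw [real_inner_self_eq_norm_sq] at this
  nlinarith [norm_nonneg e]

lemma IsFrame.halfPolarInv_eq_zero (hL : IsFrame e L) (hp : 1 ≤ p) (h0 : 0 ≤ R)
    (hR : ∀ x, f x ≠ 0 → ‖x‖ ≤ R) {τ : ℝ} (hτ : 2 * R ≤ τ) : halfPolarInv p f e L τ = 0 := by
  have hp0 : 0 < p := by linarith
  have hLc : Continuous L := L.continuous_of_finiteDimensional
  rw [halfPolarInv, ENNReal.inv_eq_zero, ← top_le_iff]
  set U : Set (Fin d → ℝ) := {w | ‖L w‖ < 1}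
  have hU : IsOpen U := isOpen_lt (by fun_prop) continuous_const
  have hUv : volume U ≠ 0 := (hU.measure_pos volume ⟨0, by simp [U]⟩).ne'
  refine le_trans ?_ (setLIntegral_le_lintegral U _)
  have : ∀ w ∈ U, shiftedGauge p f e L τ w ^ (-(1 + d : ℝ)) = ⊤ := by
    intro w hw
    have hw : ‖L w‖ < 1 := hw
    have : shiftedGauge p f e L τ w = 0 := by
      rw [shiftedGauge]
      have : ∀ x, f x * ENNReal.ofReal (⟪x, L w + e⟫ - τ) ^ p = 0 := by
        intro x
        by_cases hx : f x = 0
        · simp [hx]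
        · have h1 : ⟪x, L w + e⟫ ≤ R * 2 := by
            refine (real_inner_le_norm _ _).trans ?_
            gcongr
            · exact hR x hx
            · refine (norm_add_le _ _).trans ?_
              rw [hL.norm_eq_one]; linarith
          rw [ENNReal.ofReal_of_nonpos (by linarith), ENNReal.zero_rpow_of_pos hp0, mul_zero]
      simp [this, hp0]
    rw [this, ENNReal.zero_rpow_of_neg]
    have : (0 : ℝ) ≤ d := by positivity
    linarith
  rw [setLIntegral_congr_fun hU.measurableSet this, setLIntegral_const, ENNReal.top_mul hUv]

lemma continuous_toReal_of_convex {u : ℝ → ℝ≥0∞} (hu : ∀ τ, u τ ≠ ⊤)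
    (h : ∀ a b : ℝ, 0 < a → 0 < b → a + b = 1 → ∀ σ τ,
      u (a * σ + b * τ) ≤ ENNReal.ofReal a * u σ + ENNReal.ofReal b * u τ) :
    Continuous fun τ => (u τ).toReal := by
  rw [← continuousOn_univ]
  refine ConvexOn.continuousOn isOpen_univ (convexOn_iff_forall_pos.2 ⟨convex_univ, ?_⟩)
  intro σ _ τ _ a b ha hb hab
  have := ENNReal.toReal_mono (by have := hu σ; have := hu τ; finiteness) (h a b ha hb hab σ τ)
  rw [ENNReal.toReal_add (by have := hu σ; finiteness) (by have := hu τ; finiteness)] at this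
  simpa [ENNReal.toReal_ofReal ha.le, ENNReal.toReal_ofReal hb.le] using this

lemma lineIntegral_ne_top {n : ℕ} {f : EuclideanSpace ℝ (Fin n) → ℝ≥0∞}
    {e : EuclideanSpace ℝ (Fin n)}
    (he : ‖e‖ = 1) (hf1 : ∀ x, f x ≤ 1) (hR : ∀ x, f x ≠ 0 → ‖x‖ ≤ R)
    (x : EuclideanSpace ℝ (Fin n)) : ∫⁻ t : ℝ, f (x + t • e) ≠ ⊤ := by
  have : ∫⁻ t : ℝ, f (x + t • e) ≤ ∫⁻ t in Set.Icc (-(R + ‖x‖)) (R + ‖x‖), (1 : ℝ≥0∞) := by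
    rw [← lintegral_indicator measurableSet_Icc]
    refine lintegral_mono fun t => ?_
    by_cases hx : f (x + t • e) = 0
    · simp [hx]
    · rw [Set.indicator_of_mem]
      · exact hf1 _
      · rw [Set.mem_Icc, ← abs_le]
        have h1 := hR _ hx
        have h2 : ‖t • e‖ ≤ ‖x + t • e‖ + ‖x‖ := by
          simpa using norm_sub_le (x + t • e) x
        rw [norm_smul, he, mul_one, Real.norm_eq_abs] at h2
        linarith
  refine ne_top_of_le_ne_top ?_ this
  simp

/-- After a suitable translation in direction `e`, Steiner symmetrisation along `e` does not
decrease the polar volume. -/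
lemma exists_polarVolume_translate_le (he : ‖e‖ = 1) (hp : 1 ≤ p) (hf : Measurable f)
    (hf1 : ∀ x, f x ≤ 1) (h0 : 0 ≤ R) (hR : ∀ x, f x ≠ 0 → ‖x‖ ≤ R) :
    ∃ τ : ℝ, polarVolume p (fun x => f (x + τ • e)) ≤ polarVolume p (steiner e f) := by
  obtain ⟨L, hL⟩ := IsFrame.exists he
  have cont : ∀ e : EuclideanSpace ℝ (Fin (d + 1)),
      Continuous fun τ => (halfPolarInv p f e L τ).toReal := fun e =>
    continuous_toReal_of_convex (fun τ => halfPolarInv_ne_top hp hf hf1 hR τ)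
      fun a b ha hb hab σ τ => halfPolarInv_convex hp hf ha hb hab σ τ
  obtain ⟨τ, hτ⟩ : ∃ τ, (halfPolarInv p f e L τ).toReal -
      (halfPolarInv p f (-e) L (-τ)).toReal = 0 := by
    refine mem_range_of_exists_le_of_exists_ge
      ((cont e).sub ((cont (-e)).comp continuous_neg)) ⟨2 * R, ?_⟩ ⟨-(2 * R), ?_⟩
    · simp [hL.halfPolarInv_eq_zero hp h0 hR le_rfl]
    · simp [hL.neg.halfPolarInv_eq_zero hp h0 hR le_rfl]
  rw [sub_eq_zero, ENNReal.toReal_eq_toReal_iff' (halfPolarInv_ne_top hp hf hf1 hR τ)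
    (halfPolarInv_ne_top hp hf hf1 hR _), halfPolarInv, halfPolarInv, inv_inj] at hτ
  refine ⟨τ, ?_⟩
  have hS : steiner e (fun x => f (x + τ • e)) = steiner e f := by
    ext x
    have : ∀ x, ∫⁻ t : ℝ, f (x + t • e + τ • e) = ∫⁻ t : ℝ, f (x + t • e) := fun x => by
      simp only [← lineIntegral_add_smul e x f τ, add_right_comm]
    simp only [steiner, this]
  rw [← hS]
  refine hL.polarVolume_le_steiner hp (by fun_prop) (fun x => hf1 _) (fun x => ?_) ?_
  · have := lineIntegral_ne_top he hf1 hR (x + τ • e)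
    simpa only [add_right_comm] using this
  · have h1 : ∀ w, momentGauge p (fun x => f (x + τ • e)) (L w - e) =
        shiftedGauge p f (-e) L (-τ) w := fun w => by
      rw [← hL.neg.momentGauge_translate]
      simp [sub_eq_add_neg]
    simp only [h1, hL.momentGauge_translate, hτ]
end

section
variable {d : ℕ} {e : EuclideanSpace ℝ (Fin (d + 1))}
  {L : (Fin d → ℝ) →ₗ[ℝ] EuclideanSpace ℝ (Fin (d + 1))} {p R : ℝ}
  {f : EuclideanSpace ℝ (Fin (d + 1)) → ℝ≥0∞}

lemma lintegral_steiner (he : ‖e‖ = 1) (hf : Measurable f)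
    (hfe : ∀ x, ∫⁻ t : ℝ, f (x + t • e) ≠ ⊤) : ∫⁻ x, steiner e f x = ∫⁻ x, f x := by
  obtain ⟨L, hL⟩ := IsFrame.exists he
  rw [hL.lintegral_eq hf, hL.lintegral_eq (measurable_steiner e hf)]
  refine lintegral_congr fun z => ?_
  set l := (∫⁻ t : ℝ, f (L z + t • e)).toReal / 2
  have hl : ∫⁻ t : ℝ, f (L z + t • e) = ENNReal.ofReal (2 * l) := by
    rw [mul_div_cancel₀ _ (by norm_num), ENNReal.ofReal_toReal (hfe _)]
  simp only [hL.steiner_apply z hl]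
  rw [lintegral_indicator_one measurableSet_Ioo, hl, Real.volume_Ioo]
  congr 1
  ring

lemma norm_le_of_steiner_ne_zero (he : ‖e‖ = 1) (hf1 : ∀ x, f x ≤ 1)
    (hR : ∀ x, f x ≠ 0 → ‖x‖ ≤ R) (x : EuclideanSpace ℝ (Fin (d + 1)))
    (hx : steiner e f x ≠ 0) : ‖x‖ ≤ R := by
  by_contra! hlt
  have hx' : ENNReal.ofReal (2 * |⟪x, e⟫|) < ∫⁻ t : ℝ, f (x + t • e) := by
    by_contra h
    exact hx (Set.indicator_of_notMem (s := {x | ENNReal.ofReal (2 * |⟪x, e⟫|) <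
      ∫⁻ t : ℝ, f (x + t • e)}) h 1)
  set s := ⟪x, e⟫ with hs
  set y := x - s • e with hy
  have hxy : x = y + s • e := by simp [hy]
  have hye : ⟪y, e⟫ = 0 := by
    simp [hy, inner_sub_left, inner_smul_left, hs, he]
  have hn : ∀ t : ℝ, ‖y + t • e‖ ^ 2 = ‖y‖ ^ 2 + t ^ 2 := fun t => by
    rw [norm_add_sq_real, inner_smul_right, hye, norm_smul, he]
    simp
  have hnx : ‖x‖ ^ 2 = ‖y‖ ^ 2 + s ^ 2 := by
    conv_lhs => rw [hxy]
    exact hn s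
  rw [hxy, lineIntegral_add_smul] at hx'
  refine hx'.not_ge ?_
  calc ∫⁻ t : ℝ, f (y + t • e) ≤ ∫⁻ t in Set.Icc (-|s|) |s|, (1 : ℝ≥0∞) := by
        rw [← lintegral_indicator measurableSet_Icc]
        refine lintegral_mono fun t => ?_
        by_cases hx : f (y + t • e) = 0
        · simp [hx]
        · rw [Set.indicator_of_mem]
          · exact hf1 _
          · rw [Set.mem_Icc, ← abs_le]
            have h1 := hR _ hx
            refine sq_le_sq.1 ?_
            have h2 : ‖y + t • e‖ ^ 2 ≤ ‖x‖ ^ 2 := by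
              gcongr
              linarith
            linarith [hn t]
    _ = ENNReal.ofReal (2 * |s|) := by
        simp [two_mul]

lemma steiner_translate {c : EuclideanSpace ℝ (Fin (d + 1))} (hc : ⟪c, e⟫ = 0) :
    steiner e (fun x => f (x + c)) = fun x => steiner e f (x + c) := by
  ext x
  simp only [steiner, Set.indicator, Set.mem_ofPred_eq, inner_add_left, hc, add_zero,
    add_right_comm]
  rfl

/-- Reflection in the `i`-th coordinate hyperplane. -/
noncomputable def coordReflection {n : ℕ} (i : Fin n) (x : EuclideanSpace ℝ (Fin n)) :
    EuclideanSpace ℝ (Fin n) := x - (2 * x i) • EuclideanSpace.single i 1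

lemma coordReflection_apply {n : ℕ} (i j : Fin n) (x : EuclideanSpace ℝ (Fin n)) :
    coordReflection i x j = if j = i then -x j else x j := by
  by_cases h : j = i
  · subst h
    simp [coordReflection]; ring
  · simp [coordReflection, h]

lemma steiner_coordReflection_self {n : ℕ} {f : EuclideanSpace ℝ (Fin n) → ℝ≥0∞} (i : Fin n)
    (x : EuclideanSpace ℝ (Fin n)) :
    steiner (EuclideanSpace.single i 1) f (coordReflection i x) =
      steiner (EuclideanSpace.single i 1) f x := by
  have h1 : ∫⁻ t : ℝ, f (coordReflection i x + t • EuclideanSpace.single i 1) =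
      ∫⁻ t : ℝ, f (x + t • EuclideanSpace.single i 1) := by
    rw [coordReflection, sub_eq_add_neg, ← neg_smul, lineIntegral_add_smul]
  simp only [steiner, Set.indicator, Set.mem_ofPred_eq, h1, EuclideanSpace.inner_single_right,
    coordReflection_apply]
  simp

lemma steiner_coordReflection_of_ne {n : ℕ} {f : EuclideanSpace ℝ (Fin n) → ℝ≥0∞} {i j : Fin n}
    (hij : i ≠ j) (hf : ∀ x, f (coordReflection j x) = f x) (x : EuclideanSpace ℝ (Fin n)) :
    steiner (EuclideanSpace.single i 1) f (coordReflection j x) =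
      steiner (EuclideanSpace.single i 1) f x := by
  have h1 : ∫⁻ t : ℝ, f (coordReflection j x + t • EuclideanSpace.single i 1) =
      ∫⁻ t : ℝ, f (x + t • EuclideanSpace.single i 1) := by
    refine lintegral_congr fun t => ?_
    rw [← hf (x + _)]
    congr 1
    ext k
    by_cases hk : k = j
    · subst hk; simp [coordReflection_apply, hij.symm]
    · simp [coordReflection_apply, hk]
  simp only [steiner, Set.indicator, Set.mem_ofPred_eq, h1, EuclideanSpace.inner_single_right,
    coordReflection_apply, hij]
  simp

lemma eq_neg_of_coordReflection {n : ℕ} {g : EuclideanSpace ℝ (Fin n) → ℝ≥0∞}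
    (hg : ∀ i x, g (coordReflection i x) = g x) (x : EuclideanSpace ℝ (Fin n)) :
    g (-x) = g x := by
  have key : ∀ s : Finset (Fin n),
      g (WithLp.toLp 2 fun i => if i ∈ s then -x i else x i) = g x := by
    intro s
    induction s using Finset.induction_on with
    | empty => simp
    | insert i s hi ih =>
      rw [← ih, ← hg i]
      congr 1
      ext k
      by_cases hk : k = i
      · subst hk; simp [coordReflection_apply, hi]
      · simp [coordReflection_apply, hk]
  rw [← key Finset.univ]
  congr 1
  ext k
  simp

lemma exists_translate_symmetric (hp : 1 ≤ p) (h0 : 0 ≤ R) (s : Finset (Fin (d + 1))) :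
    ∀ f : EuclideanSpace ℝ (Fin (d + 1)) → ℝ≥0∞, Measurable f → (∀ x, f x ≤ 1) →
      (∀ x, f x ≠ 0 → ‖x‖ ≤ R) →
      ∃ (c : EuclideanSpace ℝ (Fin (d + 1))) (g : EuclideanSpace ℝ (Fin (d + 1)) → ℝ≥0∞),
        (∀ i ∉ s, c i = 0) ∧ Measurable g ∧ (∀ x, g x ≤ 1) ∧ (∀ x, g x ≠ 0 → ‖x‖ ≤ R) ∧
        ∫⁻ x, g x = ∫⁻ x, f x ∧ (∀ i ∈ s, ∀ x, g (coordReflection i x) = g x) ∧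
        (∀ i ∉ s, (∀ x, f (coordReflection i x) = f x) → ∀ x, g (coordReflection i x) = g x) ∧
        polarVolume p (fun x => f (x + c)) ≤ polarVolume p g := by
  induction s using Finset.induction_on with
  | empty =>
    intro f hf hf1 hR
    exact ⟨0, f, by simp, hf, hf1, hR, rfl, by simp, fun i _ h => h, by simp⟩
  | insert i s hi ih =>
    intro f hf hf1 hR
    set e : EuclideanSpace ℝ (Fin (d + 1)) := EuclideanSpace.single i 1 with he
    have he1 : ‖e‖ = 1 := by simp [he]
    obtain ⟨c, g, hc, hg, hg1, hgR, hgi, hgs, hgs', hle⟩ := ih (steiner e f)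
      (measurable_steiner e hf) (steiner_le_one e f) (norm_le_of_steiner_ne_zero he1 hf1 hR)
    have hce : ⟪c, e⟫ = 0 := by simp [he, EuclideanSpace.inner_single_right, hc i hi]
    obtain ⟨τ, hτ⟩ := exists_polarVolume_translate_le (f := fun x => f (x + c)) (R := R + ‖c‖)
      he1 hp (by fun_prop) (fun x => hf1 _) (by positivity) (fun x hx => by
        have h1 := hR _ hx
        have h2 := norm_sub_le (x + c) c
        rw [add_sub_cancel_right] at h2
        linarith)
    refine ⟨c + τ • e, g, fun j hj => ?_, hg, hg1, hgR, ?_, fun j hj x => ?_, fun j hj hfj => ?_,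
        ?_⟩
    · rw [Finset.mem_insert, not_or] at hj
      simp [hc j hj.2, he, hj.1]
    · rw [hgi, lintegral_steiner he1 hf (lineIntegral_ne_top he1 hf1 hR)]
    · rcases Finset.mem_insert.1 hj with rfl | hj
      · exact hgs' j hi (steiner_coordReflection_self j) x
      · exact hgs j hj x
    · rw [Finset.mem_insert, not_or] at hj
      exact hgs' j hj.2 (steiner_coordReflection_of_ne (Ne.symm hj.1) hfj)
    · refine le_trans ?_ hle
      rw [steiner_translate hce] at hτ
      have : ∀ x, x + (c + τ • e) = x + τ • e + c := fun x => by abel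
      simpa only [this] using hτ

/-- Some translate of `f` has polar volume at most that of an even function with the same integral
and the same bounds. -/
lemma exists_translate_even (hp : 1 ≤ p) (h0 : 0 ≤ R) (hf : Measurable f)
    (hf1 : ∀ x, f x ≤ 1) (hR : ∀ x, f x ≠ 0 → ‖x‖ ≤ R) :
    ∃ (c : EuclideanSpace ℝ (Fin (d + 1))) (g : EuclideanSpace ℝ (Fin (d + 1)) → ℝ≥0∞),
      Measurable g ∧ (∀ x, g x ≤ 1) ∧ (∀ x, g x ≠ 0 → ‖x‖ ≤ R) ∧ ∫⁻ x, g x = ∫⁻ x, f x ∧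
      (∀ x, g (-x) = g x) ∧ polarVolume p (fun x => f (x + c)) ≤ polarVolume p g := by
  obtain ⟨c, g, -, hg, hg1, hgR, hgi, hgs, -, hle⟩ :=
    exists_translate_symmetric hp h0 Finset.univ f hf hf1 hR
  exact ⟨c, g, hg, hg1, hgR, hgi,
    eq_neg_of_coordReflection fun i x => hgs i (Finset.mem_univ i) x, hle⟩

/-- For even functions Steiner symmetrisation does not decrease the polar volume. -/
lemma polarVolume_le_steiner_of_even (he : ‖e‖ = 1) (hp : 1 ≤ p) (hf : Measurable f)
    (hf1 : ∀ x, f x ≤ 1) (hR : ∀ x, f x ≠ 0 → ‖x‖ ≤ R) (heven : ∀ x, f (-x) = f x) :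
    polarVolume p f ≤ polarVolume p (steiner e f) := by
  obtain ⟨L, hL⟩ := IsFrame.exists he
  refine hL.polarVolume_le_steiner hp hf hf1 (lineIntegral_ne_top he hf1 hR) ?_
  have hG : ∀ y, momentGauge p f (-y) = momentGauge p f y := by
    intro y
    rw [momentGauge, momentGauge, oneSidedMoment, oneSidedMoment, ← lintegral_neg_eq_self]
    simp [heven]
  rw [← lintegral_neg_eq_self]
  refine lintegral_congr fun w => ?_
  rw [← hG, neg_add, map_neg, neg_neg, sub_eq_add_neg]

lemma steiner_even (heven : ∀ x, f (-x) = f x) (x : EuclideanSpace ℝ (Fin (d + 1))) :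
    steiner e f (-x) = steiner e f x := by
  have h1 : ∫⁻ t : ℝ, f (-x + t • e) = ∫⁻ t : ℝ, f (x + t • e) := by
    rw [← lintegral_neg_eq_self]
    refine lintegral_congr fun t => ?_
    rw [← heven]
    simp [add_comm]
  simp only [steiner, Set.indicator, Set.mem_ofPred_eq, h1, inner_neg_left, abs_neg]
  simp
end

section
variable {d : ℕ} {e : EuclideanSpace ℝ (Fin (d + 1))} {p R : ℝ}
  {f g : EuclideanSpace ℝ (Fin (d + 1)) → ℝ≥0∞}

/-- The surface measure of the unit sphere of `ℝ^(d + 1)`. -/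
noncomputable abbrev surface (d : ℕ) :
    Measure (Metric.sphere (0 : EuclideanSpace ℝ (Fin (d + 1))) 1) :=
  (volume : Measure (EuclideanSpace ℝ (Fin (d + 1)))).toSphere

/-- Integration in polar coordinates. -/
lemma lintegral_eq_lintegral_toSphere (hf : Measurable f) :
    ∫⁻ y, f y = ∫⁻ ξ, (∫⁻ s in Set.Ioi (0 : ℝ), ENNReal.ofReal s ^ d *
      f (s • (ξ : EuclideanSpace ℝ (Fin (d + 1))))) ∂(surface d) := by
  have hmp :=
      (volume : Measure (EuclideanSpace ℝ (Fin (d + 1)))).measurePreserving_homeomorphUnitSphereProd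
  have h1 : ∫⁻ y, f y = ∫⁻ y : ({0}ᶜ : Set (EuclideanSpace ℝ (Fin (d + 1)))),
      f (y : EuclideanSpace ℝ (Fin (d + 1)))
      ∂(volume.comap Subtype.val) := by
    rw [lintegral_subtype_comap (measurableSet_singleton _).compl, restrict_compl_singleton]
  have h2 : ∀ y : ({0}ᶜ : Set (EuclideanSpace ℝ (Fin (d + 1)))), f y =
      (fun q : Metric.sphere (0 : EuclideanSpace ℝ (Fin (d + 1))) 1 × Set.Ioi (0 : ℝ) =>
        f ((q.2 : ℝ) • (q.1 : EuclideanSpace ℝ (Fin (d + 1)))))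
        (homeomorphUnitSphereProd _ y) := by
    intro y
    have : (y : EuclideanSpace ℝ (Fin (d + 1))) ≠ 0 := y.2
    have : ‖(y : EuclideanSpace ℝ (Fin (d + 1)))‖ ≠ 0 := by simpa using this
    simp [smul_smul, this]
  have hm : Measurable (fun q : Metric.sphere (0 : EuclideanSpace ℝ (Fin (d + 1))) 1 ×
      Set.Ioi (0 : ℝ) =>
        f ((q.2 : ℝ) • (q.1 : EuclideanSpace ℝ (Fin (d + 1))))) := by
    fun_prop
  rw [h1, lintegral_congr h2, hmp.lintegral_comp hm, lintegral_prod _ hm.aemeasurable]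
  refine lintegral_congr fun ξ => ?_
  rw [Measure.volumeIoiPow, lintegral_withDensity_eq_lintegral_mul _ (by fun_prop) (by fun_prop),
    ← lintegral_subtype_comap measurableSet_Ioi]
  refine lintegral_congr fun s => ?_
  simp [ENNReal.ofReal_pow s.2.out.le]

lemma ENNReal.mul_le_mul_min {F C K : ℝ≥0∞} (hF : F ≤ K) (hC : C ≤ K) : F * C ≤ K * min F C := by
  rcases le_total F C with h | h
  · rw [min_eq_left h, mul_comm]; gcongr
  · rw [min_eq_right h]; gcongr

/-- Centring the mass of a line moves a definite amount into a centred interval. -/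
lemma lintegral_Ioo_gain {G : ℝ → ℝ≥0∞} (hG : Measurable G) (hG1 : ∀ t, G t ≤ 1) {j l : ℝ}
    {K : ℝ≥0∞} (hl : ∫⁻ t, G t = ENNReal.ofReal (2 * l)) (hK : ∫⁻ t, G t ≤ K)
    (hj : ENNReal.ofReal (2 * j) ≤ K) :
    K * (∫⁻ t, (Set.Ioo (-j) j).indicator G t) +
      (∫⁻ t, (Set.Ioo (-j) j)ᶜ.indicator G t) *
        (∫⁻ t, (Set.Ioo (-j) j).indicator (fun t => 1 - G t) t) ≤
    K * ∫⁻ t, (Set.Ioo (-j) j).indicator ((Set.Ioo (-l) l).indicator 1) t := by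
  have hJ : MeasurableSet (Set.Ioo (-j) j) := measurableSet_Ioo
  have h1 : (∫⁻ t, (Set.Ioo (-j) j).indicator G t) + (∫⁻ t, (Set.Ioo (-j) j)ᶜ.indicator G t) =
      ENNReal.ofReal (2 * l) := by
    rw [← hl, lintegral_indicator hJ, lintegral_indicator hJ.compl, lintegral_add_compl _ hJ]
  have h2 : (∫⁻ t, (Set.Ioo (-j) j).indicator G t) +
      (∫⁻ t, (Set.Ioo (-j) j).indicator (fun t => 1 - G t) t) = ENNReal.ofReal (2 * j) := by
    rw [← lintegral_add_left (hG.indicator hJ)]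
    have : ∀ t, (Set.Ioo (-j) j).indicator G t +
        (Set.Ioo (-j) j).indicator (fun t => 1 - G t) t = (Set.Ioo (-j) j).indicator 1 t := by
      intro t
      by_cases ht : t ∈ Set.Ioo (-j) j
      · simp only [Set.indicator_of_mem ht, Pi.one_apply]
        exact add_tsub_cancel_of_le (hG1 t)
      · simp only [Set.indicator_of_notMem ht, add_zero]
    rw [lintegral_congr this, lintegral_indicator_one hJ, Real.volume_Ioo]
    congr 1; ring
  have h3 : ∫⁻ t, (Set.Ioo (-j) j).indicator ((Set.Ioo (-l) l).indicator 1) t =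
      min (ENNReal.ofReal (2 * l)) (ENNReal.ofReal (2 * j)) := by
    rw [Set.indicator_indicator, Set.Ioo_inter_Ioo,
      lintegral_indicator_one measurableSet_Ioo, Real.volume_Ioo]
    rw [← ENNReal.ofReal_min]
    congr 1
    rw [max_neg_neg, sub_neg_eq_add, ← two_mul, min_comm, mul_min_of_nonneg _ _ zero_le_two]
  rw [h3, ← h1, ← h2, min_add_add_left, mul_add]
  refine add_le_add le_rfl (ENNReal.mul_le_mul_min (le_trans ?_ hK) (le_trans ?_ hj))
  · rw [hl, ← h1]; exact le_add_self
  · rw [← h2]; exact le_add_self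

lemma IsFrame.norm_sq {L : (Fin d → ℝ) →ₗ[ℝ] EuclideanSpace ℝ (Fin (d + 1))}
    (hL : IsFrame e L) (z : Fin d → ℝ) (t : ℝ) : ‖L z + t • e‖ ^ 2 = ‖L z‖ ^ 2 + t ^ 2 := by
  rw [← real_inner_self_eq_norm_sq, hL.inner_add, real_inner_self_eq_norm_sq, sq t]

lemma IsFrame.mem_ball {L : (Fin d → ℝ) →ₗ[ℝ] EuclideanSpace ℝ (Fin (d + 1))}
    (hL : IsFrame e L) {r : ℝ} (hr : 0 ≤ r) (z : Fin d → ℝ) (t : ℝ) :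
    L z + t • e ∈ Metric.ball (0 : EuclideanSpace ℝ (Fin (d + 1))) r ↔
      t ∈ Set.Ioo (-√(r ^ 2 - ‖L z‖ ^ 2)) (√(r ^ 2 - ‖L z‖ ^ 2)) := by
  rw [Set.mem_Ioo, ← abs_lt, Real.lt_sqrt (abs_nonneg _), sq_abs, mem_ball_zero_iff,
    ← sq_lt_sq₀ (norm_nonneg _) hr, hL.norm_sq, lt_sub_iff_add_lt']

lemma IsFrame.steiner_gain {L : (Fin d → ℝ) →ₗ[ℝ] EuclideanSpace ℝ (Fin (d + 1))}
    (hL : IsFrame e L) {r : ℝ} (hr : 0 ≤ r) (hrR : r ≤ R) (hg : Measurable g)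
    (hg1 : ∀ x, g x ≤ 1) (hR : ∀ x, g x ≠ 0 → ‖x‖ ≤ R) :
    ENNReal.ofReal (2 * R) * (∫⁻ x in Metric.ball 0 r, g x) +
      (∫⁻ x, (Metric.ball 0 r)ᶜ.indicator g x *
        ∫⁻ s : ℝ, (Metric.ball 0 r).indicator (fun y => 1 - g y) (x + s • e)) ≤
    ENNReal.ofReal (2 * R) * ∫⁻ x in Metric.ball 0 r, steiner e g x := by
  have hB : MeasurableSet (Metric.ball (0 : EuclideanSpace ℝ (Fin (d + 1))) r) :=
    measurableSet_ball
  have hv : Measurable ((Metric.ball 0 r).indicator (fun y => 1 - g y)) :=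
    (measurable_const.sub hg).indicator hB
  have hS := measurable_steiner e hg
  rw [← lintegral_indicator hB, ← lintegral_indicator hB, hL.lintegral_eq (hg.indicator hB),
    hL.lintegral_eq (F := fun x => (Metric.ball 0 r)ᶜ.indicator g x *
      ∫⁻ s : ℝ, (Metric.ball 0 r).indicator (fun y => 1 - g y) (x + s • e))
      ((hg.indicator hB.compl).mul (measurable_lineIntegral e hv)),
    hL.lintegral_eq (hS.indicator hB)]
  rw [← lintegral_const_mul, ← lintegral_const_mul, ← lintegral_add_left]
  · refine lintegral_mono fun z => ?_
    have hGm : Measurable fun t : ℝ => g (L z + t • e) := by fun_prop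
    set j := √(r ^ 2 - ‖L z‖ ^ 2) with hj
    have hind : ∀ (h : EuclideanSpace ℝ (Fin (d + 1)) → ℝ≥0∞) (t : ℝ),
        (Metric.ball 0 r).indicator h (L z + t • e) =
          (Set.Ioo (-j) j).indicator (fun t => h (L z + t • e)) t := by
      intro h t
      have := hL.mem_ball hr z t
      by_cases ht : t ∈ Set.Ioo (-j) j
      · rw [Set.indicator_of_mem ht, Set.indicator_of_mem (this.2 ht)]
      · rw [Set.indicator_of_notMem ht, Set.indicator_of_notMem (fun h => ht (this.1 h))]
    have hindc : ∀ (h : EuclideanSpace ℝ (Fin (d + 1)) → ℝ≥0∞) (t : ℝ),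
        (Metric.ball 0 r)ᶜ.indicator h (L z + t • e) =
          (Set.Ioo (-j) j)ᶜ.indicator (fun t => h (L z + t • e)) t := by
      intro h t
      have := hL.mem_ball hr z t
      by_cases ht : t ∈ Set.Ioo (-j) j
      · rw [Set.indicator_of_notMem (Set.notMem_compl_iff.2 (this.2 ht)),
          Set.indicator_of_notMem (Set.notMem_compl_iff.2 ht)]
      · rw [Set.indicator_of_mem (Set.mem_compl (mt this.1 ht)),
          Set.indicator_of_mem (Set.mem_compl ht)]
    have hlt := lineIntegral_ne_top hL.norm_eq_one hg1 hR (L z)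
    obtain ⟨l, hl⟩ : ∃ l : ℝ, ∫⁻ t : ℝ, g (L z + t • e) = ENNReal.ofReal (2 * l) :=
      ⟨(∫⁻ t : ℝ, g (L z + t • e)).toReal / 2, by
        rw [mul_div_cancel₀ _ two_ne_zero, ENNReal.ofReal_toReal hlt]⟩
    have hK : ∫⁻ t : ℝ, g (L z + t • e) ≤ ENNReal.ofReal (2 * R) := by
      calc ∫⁻ t : ℝ, g (L z + t • e) ≤ ∫⁻ t : ℝ, (Set.Icc (-R) R).indicator 1 t := by
            refine lintegral_mono fun t => ?_
            by_cases ht : g (L z + t • e) = 0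
            · rw [ht]; exact zero_le
            · have h1 := hR _ ht
              have h2 : t ∈ Set.Icc (-R) R := by
                rw [Set.mem_Icc, ← abs_le]
                refine le_trans (abs_le_of_sq_le_sq ?_ (norm_nonneg _)) h1
                rw [hL.norm_sq]; nlinarith [sq_nonneg ‖L z‖]
              rw [Set.indicator_of_mem h2]
              exact hg1 _
        _ = ENNReal.ofReal (2 * R) := by
            rw [lintegral_indicator_one measurableSet_Icc, Real.volume_Icc]
            congr 1; ring
    have hjK : ENNReal.ofReal (2 * j) ≤ ENNReal.ofReal (2 * R) := by
      have : j ≤ r := by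
        rw [hj]
        exact Real.sqrt_le_iff.2 ⟨hr, by nlinarith [sq_nonneg ‖L z‖]⟩
      exact ENNReal.ofReal_le_ofReal (by linarith)
    have key := lintegral_Ioo_gain hGm (fun t => hg1 _) hl hK hjK
    simp only [lineIntegral_add_smul, hind, hindc, hL.steiner_apply z hl]
    rw [lintegral_mul_const _ (hGm.indicator measurableSet_Ioo.compl)]
    exact key
  · refine Measurable.const_mul ?_ _
    exact Measurable.lintegral_prod_right' (f := fun q : (Fin d → ℝ) × ℝ =>
      (Metric.ball 0 r).indicator g (L q.1 + q.2 • e))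
      ((hg.indicator hB).comp hL.measurePreserving.measurable)
  · exact Measurable.lintegral_prod_right' (f := fun q : (Fin d → ℝ) × ℝ =>
      (Metric.ball 0 r).indicator (steiner e g) (L q.1 + q.2 • e))
      ((hS.indicator hB).comp hL.measurePreserving.measurable)
  · exact Measurable.lintegral_prod_right' (f := fun q : (Fin d → ℝ) × ℝ =>
      (Metric.ball 0 r).indicator g (L q.1 + q.2 • e))
      ((hg.indicator hB).comp hL.measurePreserving.measurable)
end

section
variable {d : ℕ} {e : EuclideanSpace ℝ (Fin (d + 1))} {p R r : ℝ}
  {f g u v : EuclideanSpace ℝ (Fin (d + 1)) → ℝ≥0∞}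

/-- Averaging the line correlation of two bounded sets over all directions. -/
lemma lintegral_mul_lintegral_le_average (hu : Measurable u) (hv : Measurable v)
    (huR : ∀ x, u x ≠ 0 → ‖x‖ ≤ R) (hvR : ∀ x, v x ≠ 0 → ‖x‖ ≤ R) :
    (∫⁻ x, u x) * ∫⁻ x, v x ≤ ENNReal.ofReal (2 * R) ^ d *
      ∫⁻ ξ, (∫⁻ x, u x * ∫⁻ s : ℝ, v (x + s • (ξ : EuclideanSpace ℝ (Fin (d + 1)))))
        ∂(surface d) := by
  have hm : Measurable fun q : Metric.sphere (0 : EuclideanSpace ℝ (Fin (d + 1))) 1 ×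
      EuclideanSpace ℝ (Fin (d + 1)) =>
      ∫⁻ s : ℝ, v (q.2 + s • (q.1 : EuclideanSpace ℝ (Fin (d + 1)))) :=
    Measurable.lintegral_prod_right' (f := fun q : (Metric.sphere
      (0 : EuclideanSpace ℝ (Fin (d + 1))) 1 × EuclideanSpace ℝ (Fin (d + 1))) × ℝ =>
      v (q.1.2 + q.2 • (q.1.1 : EuclideanSpace ℝ (Fin (d + 1))))) (by fun_prop)
  rw [lintegral_lintegral_swap ((hu.comp measurable_snd).mul hm).aemeasurable,
    ← lintegral_mul_const _ hu, ← lintegral_const_mul]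
  · refine lintegral_mono fun x => ?_
    have hx : Measurable fun ξ : Metric.sphere (0 : EuclideanSpace ℝ (Fin (d + 1))) 1 =>
        ∫⁻ s : ℝ, v (x + s • (ξ : EuclideanSpace ℝ (Fin (d + 1)))) :=
      hm.comp (measurable_id.prodMk measurable_const)
    rw [lintegral_const_mul _ hx, mul_left_comm]
    by_cases hux : u x = 0
    · simp [hux]
    gcongr
    rw [← lintegral_add_left_eq_self v x, lintegral_eq_lintegral_toSphere (by fun_prop),
      ← lintegral_const_mul _ hx]
    refine lintegral_mono fun ξ => ?_
    rw [← lintegral_const_mul _ (by fun_prop), ← lintegral_indicator measurableSet_Ioi]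
    refine lintegral_mono fun s => ?_
    by_cases hs : s ∈ Set.Ioi (0 : ℝ)
    · rw [Set.indicator_of_mem hs]
      by_cases hy : v (x + s • (ξ : EuclideanSpace ℝ (Fin (d + 1)))) = 0
      · simp [hy]
      have h1 := hvR _ hy
      have h2 := huR _ hux
      have h3 : ‖s • (ξ : EuclideanSpace ℝ (Fin (d + 1)))‖ = s := by
        rw [norm_smul, norm_eq_of_mem_sphere, mul_one, Real.norm_of_nonneg (le_of_lt hs)]
      have h4 : s ≤ 2 * R := by
        have := norm_sub_le (x + s • (ξ : EuclideanSpace ℝ (Fin (d + 1)))) x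
        rw [add_sub_cancel_left, h3] at this
        linarith
      gcongr
    · rw [Set.indicator_of_notMem hs]; exact zero_le
  · exact Measurable.lintegral_prod_left' (f := fun q : Metric.sphere
      (0 : EuclideanSpace ℝ (Fin (d + 1))) 1 × EuclideanSpace ℝ (Fin (d + 1)) =>
      u q.2 * ∫⁻ s : ℝ, v (q.2 + s • (q.1 : EuclideanSpace ℝ (Fin (d + 1)))))
      ((hu.comp measurable_snd).mul hm)

lemma exists_steiner_gain (hr : 0 ≤ r) (hrR : r ≤ R) (hg : Measurable g)
    (hg1 : ∀ x, g x ≤ 1) (hR : ∀ x, g x ≠ 0 → ‖x‖ ≤ R) :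
    ∃ e : EuclideanSpace ℝ (Fin (d + 1)), ‖e‖ = 1 ∧
      surface d Set.univ * ENNReal.ofReal (2 * R) ^ (d + 1) * (∫⁻ x in Metric.ball 0 r, g x) +
        (∫⁻ x in (Metric.ball 0 r)ᶜ, g x) * (∫⁻ x in Metric.ball 0 r, 1 - g x) ≤
      surface d Set.univ * ENNReal.ofReal (2 * R) ^ (d + 1) *
        ∫⁻ x in Metric.ball 0 r, steiner e g x := by
  have hB : MeasurableSet (Metric.ball (0 : EuclideanSpace ℝ (Fin (d + 1))) r) :=
    measurableSet_ball
  set u := (Metric.ball 0 r)ᶜ.indicator g with hu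
  set v := (Metric.ball 0 r).indicator (fun y => 1 - g y) with hv
  set Φ : Metric.sphere (0 : EuclideanSpace ℝ (Fin (d + 1))) 1 → ℝ≥0∞ := fun ξ =>
    ∫⁻ x, u x * ∫⁻ s : ℝ, v (x + s • (ξ : EuclideanSpace ℝ (Fin (d + 1)))) with hΦ
  have h1 := lintegral_mul_lintegral_le_average (u := u) (v := v) (R := R)
    (hg.indicator hB.compl)
    ((measurable_const.sub hg).indicator hB) (fun x hx => hR x fun h => hx (by
      simp [hu, Set.indicator, h])) (fun x hx => by
      have := Set.mem_of_indicator_ne_zero hx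
      rw [mem_ball_zero_iff] at this
      linarith)
  have h2 : ∀ ξ, ENNReal.ofReal (2 * R) * (∫⁻ x in Metric.ball 0 r, g x) + Φ ξ ≤
      ENNReal.ofReal (2 * R) * ∫⁻ x in Metric.ball 0 r,
        steiner (ξ : EuclideanSpace ℝ (Fin (d + 1))) g x := fun ξ => by
    obtain ⟨L, hL⟩ := IsFrame.exists (norm_eq_of_mem_sphere ξ)
    exact hL.steiner_gain hr hrR hg hg1 hR
  have h3 : ∫⁻ ξ, Φ ξ ∂(surface d) ≠ ⊤ := by
    refine ne_top_of_le_ne_top (b := ∫⁻ ξ, ENNReal.ofReal (2 * R) *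
      volume (Metric.ball (0 : EuclideanSpace ℝ (Fin (d + 1))) r) ∂(surface d)) ?_
      (lintegral_mono fun ξ => (le_add_self.trans (h2 ξ)).trans ?_)
    · rw [lintegral_const]
      exact ENNReal.mul_ne_top (ENNReal.mul_ne_top ENNReal.ofReal_ne_top
        measure_ball_lt_top.ne) (measure_ne_top _ _)
    · gcongr
      exact (lintegral_mono fun x => steiner_le_one _ g x).trans_eq (by simp)
  obtain ⟨ξ, hξ⟩ := exists_laverage_le (Measure.toSphere_ne_zero volume) h3
  rw [laverage_eq] at hξ
  have h4 : ∫⁻ ξ, Φ ξ ∂(surface d) ≤ surface d Set.univ * Φ ξ := by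
    rw [mul_comm]
    rwa [ENNReal.div_le_iff_le_mul] at hξ
    · exact Or.inl (Measure.measure_univ_ne_zero.2 (Measure.toSphere_ne_zero volume))
    · exact Or.inl (measure_ne_top _ _)
  refine ⟨ξ, norm_eq_of_mem_sphere ξ, ?_⟩
  rw [← lintegral_indicator hB.compl, ← lintegral_indicator hB (fun x => 1 - g x)]
  calc _ ≤ surface d Set.univ * ENNReal.ofReal (2 * R) ^ (d + 1) *
          (∫⁻ x in Metric.ball 0 r, g x) +
        ENNReal.ofReal (2 * R) ^ d * (surface d Set.univ * Φ ξ) := by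
        exact add_le_add le_rfl (h1.trans (by gcongr))
    _ = surface d Set.univ * ENNReal.ofReal (2 * R) ^ d * (ENNReal.ofReal (2 * R) *
          (∫⁻ x in Metric.ball 0 r, g x) + Φ ξ) := by ring
    _ ≤ surface d Set.univ * ENNReal.ofReal (2 * R) ^ d * (ENNReal.ofReal (2 * R) *
          ∫⁻ x in Metric.ball 0 r, steiner (ξ : EuclideanSpace ℝ (Fin (d + 1))) g x) := by
        gcongr
        exact h2 ξ
    _ = _ := by ring
end

section
variable {d : ℕ} {e : EuclideanSpace ℝ (Fin (d + 1))} {p R r : ℝ}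
  {f g u v : EuclideanSpace ℝ (Fin (d + 1)) → ℝ≥0∞}

lemma lintegral_ball_one_sub (hg : Measurable g) (hg1 : ∀ x, g x ≤ 1)
    (hm : ∫⁻ x, g x = volume (Metric.ball (0 : EuclideanSpace ℝ (Fin (d + 1))) r)) :
    ∫⁻ x in Metric.ball 0 r, 1 - g x = ∫⁻ x in (Metric.ball 0 r)ᶜ, g x := by
  have h1 := lintegral_add_compl g
    (measurableSet_ball (x := (0 : EuclideanSpace ℝ (Fin (d + 1)))) (ε := r)) (μ := volume)
  have hfin : ∫⁻ x in Metric.ball 0 r, g x ≠ ⊤ := by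
    refine ne_top_of_le_ne_top (b := ∫⁻ x, g x) ?_ (setLIntegral_le_lintegral _ _)
    rw [hm]; exact measure_ball_lt_top.ne
  rw [lintegral_sub hg hfin (Filter.Eventually.of_forall hg1), setLIntegral_one, ← hm, ← h1,
    ENNReal.add_sub_cancel_left hfin]

/-- Repeated Steiner symmetrisation brings an even function arbitrarily close to the
indicator function of a ball. -/
lemma exists_lintegral_compl_ball_le (hp : 1 ≤ p) (hr : 0 ≤ r) (hrR : r ≤ R)
    (hf : Measurable f) (hf1 : ∀ x, f x ≤ 1) (hR : ∀ x, f x ≠ 0 → ‖x‖ ≤ R)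
    (heven : ∀ x, f (-x) = f x)
    (hm : ∫⁻ x, f x = volume (Metric.ball (0 : EuclideanSpace ℝ (Fin (d + 1))) r))
    {ε : ℝ≥0∞} (hε : ε ≠ 0) :
    ∃ g : EuclideanSpace ℝ (Fin (d + 1)) → ℝ≥0∞, Measurable g ∧ (∀ x, g x ≤ 1) ∧
      polarVolume p f ≤ polarVolume p g ∧ ∫⁻ x in Metric.ball 0 r, 1 - g x ≤ ε := by
  by_contra! H
  have key : ∀ k : ℕ, ∃ g : EuclideanSpace ℝ (Fin (d + 1)) → ℝ≥0∞, Measurable g ∧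
      (∀ x, g x ≤ 1) ∧ (∀ x, g x ≠ 0 → ‖x‖ ≤ R) ∧ (∀ x, g (-x) = g x) ∧
      ∫⁻ x, g x = volume (Metric.ball (0 : EuclideanSpace ℝ (Fin (d + 1))) r) ∧
      polarVolume p f ≤ polarVolume p g ∧ k * (ε * ε) ≤
        surface d Set.univ * ENNReal.ofReal (2 * R) ^ (d + 1) *
          ∫⁻ x in Metric.ball 0 r, g x := by
    intro k
    induction k with
    | zero => exact ⟨f, hf, hf1, hR, heven, hm, le_rfl, by simp⟩
    | succ k ih =>
      obtain ⟨g, hg, hg1, hgR, hge, hgm, hgp, hgk⟩ := ih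
      obtain ⟨e, he, hgain⟩ := exists_steiner_gain hr hrR hg hg1 hgR
      refine ⟨steiner e g, measurable_steiner e hg, steiner_le_one e g,
        norm_le_of_steiner_ne_zero he hg1 hgR, steiner_even hge,
        (lintegral_steiner he hg (lineIntegral_ne_top he hg1 hgR)).trans hgm,
        hgp.trans (polarVolume_le_steiner_of_even he hp hg hg1 hgR hge), le_trans ?_ hgain⟩
      have h1 := (H g hg hg1 hgp).le
      rw [← lintegral_ball_one_sub hg hg1 hgm]
      push_cast
      rw [add_mul, one_mul]
      gcongr
  have hfin : surface d Set.univ * ENNReal.ofReal (2 * R) ^ (d + 1) *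
      volume (Metric.ball (0 : EuclideanSpace ℝ (Fin (d + 1))) r) ≠ ⊤ :=
    ENNReal.mul_ne_top (ENNReal.mul_ne_top (measure_ne_top _ _)
      (ENNReal.pow_ne_top ENNReal.ofReal_ne_top)) measure_ball_lt_top.ne
  obtain ⟨k, hk⟩ := ENNReal.exists_nat_mul_gt (mul_ne_zero hε hε) hfin
  obtain ⟨g, -, -, -, -, hgm, -, hgk⟩ := key k
  refine absurd (hk.trans_le hgk) (not_lt.2 ?_)
  gcongr
  rw [← hgm]
  exact setLIntegral_le_lintegral _ _

lemma polarVolume_le_of_even (hp : 1 ≤ p) (hr : 0 ≤ r) (hrR : r ≤ R)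
    (hf : Measurable f) (hf1 : ∀ x, f x ≤ 1) (hR : ∀ x, f x ≠ 0 → ‖x‖ ≤ R)
    (heven : ∀ x, f (-x) = f x)
    (hm : ∫⁻ x, f x = volume (Metric.ball (0 : EuclideanSpace ℝ (Fin (d + 1))) r))
    {a : ℝ} (ha : 0 < a) (hA : ∀ y : EuclideanSpace ℝ (Fin (d + 1)),
      ∫⁻ x in Metric.ball 0 r, ENNReal.ofReal ⟪x, y⟫ ^ p = ENNReal.ofReal (a * ‖y‖ ^ p)) :
    polarVolume p f ≤
      volume (Metric.ball (0 : EuclideanSpace ℝ (Fin (d + 1))) (a ^ (-(1 / p)))) := by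
  have hp0 : 0 < p := by linarith
  have key : ∀ b, 0 < b → b < a → polarVolume p f ≤
      volume (Metric.ball (0 : EuclideanSpace ℝ (Fin (d + 1))) (b ^ (-(1 / p)))) := by
    intro b hb hba
    set δ : ℝ := (a - b) / (r ^ p + 1) with hδ
    have hrp : 0 ≤ r ^ p := by positivity
    have hδ0 : 0 < δ := div_pos (by linarith) (by positivity)
    have hδr : δ * r ^ p ≤ a - b := by
      rw [hδ, div_mul_eq_mul_div, div_le_iff₀ (by positivity)]
      nlinarith
    obtain ⟨g, hg, hg1, hle, hgδ⟩ := exists_lintegral_compl_ball_le hp hr hrR hf hf1 hR heven hm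
      (ε := ENNReal.ofReal δ) (by simpa using hδ0)
    refine hle.trans (measure_mono fun y hy => ?_)
    have hy1 : oneSidedMoment p g y < 1 := by
      have : momentGauge p g y < 1 := hy
      rw [momentGauge] at this
      by_contra! h
      exact absurd this (not_lt.2 (ENNReal.one_le_rpow h (by positivity)))
    have h1 : ENNReal.ofReal (a * ‖y‖ ^ p) ≤
        oneSidedMoment p g y + ENNReal.ofReal (δ * (r * ‖y‖) ^ p) := by
      rw [← hA]
      calc ∫⁻ x in Metric.ball 0 r, ENNReal.ofReal ⟪x, y⟫ ^ p
          = ∫⁻ x in Metric.ball 0 r, (g x * ENNReal.ofReal ⟪x, y⟫ ^ p +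
              (1 - g x) * ENNReal.ofReal ⟪x, y⟫ ^ p) := by
            refine lintegral_congr fun x => ?_
            rw [← add_mul, add_tsub_cancel_of_le (hg1 x), one_mul]
        _ = (∫⁻ x in Metric.ball 0 r, g x * ENNReal.ofReal ⟪x, y⟫ ^ p) +
              ∫⁻ x in Metric.ball 0 r, (1 - g x) * ENNReal.ofReal ⟪x, y⟫ ^ p :=
            lintegral_add_left (by fun_prop) _
        _ ≤ oneSidedMoment p g y + ∫⁻ x in Metric.ball 0 r, (1 - g x) *
              ENNReal.ofReal ((r * ‖y‖) ^ p) := by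
            refine add_le_add (setLIntegral_le_lintegral _ _)
              (setLIntegral_mono (by fun_prop) fun x hx => ?_)
            rw [← ENNReal.ofReal_rpow_of_nonneg (by positivity) hp0.le]
            gcongr
            refine (real_inner_le_norm x y).trans ?_
            gcongr
            exact (mem_ball_zero_iff.1 hx).le
        _ ≤ _ := by
            rw [lintegral_mul_const _ (by fun_prop), ENNReal.ofReal_mul hδ0.le]
            gcongr
    have h2 : a * ‖y‖ ^ p < 1 + δ * (r * ‖y‖) ^ p := by
      have := h1.trans_lt (ENNReal.add_lt_add_right ENNReal.ofReal_ne_top hy1)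
      rw [← ENNReal.ofReal_one, ← ENNReal.ofReal_add zero_le_one (by positivity)] at this
      exact (ENNReal.ofReal_lt_ofReal_iff (by positivity)).1 this
    have h3 : b * ‖y‖ ^ p < 1 := by
      rw [Real.mul_rpow hr (norm_nonneg _)] at h2
      have : 0 ≤ ‖y‖ ^ p := by positivity
      nlinarith
    rw [mem_ball_zero_iff, Real.rpow_neg hb.le, ← Real.inv_rpow hb.le, one_div,
      Real.lt_rpow_inv_iff_of_pos (norm_nonneg _) (by positivity) hp0, ← one_div, lt_div_iff₀' hb]
    exact h3
  have hlim : Filter.Tendsto (fun b : ℝ => volume (Metric.ball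
      (0 : EuclideanSpace ℝ (Fin (d + 1))) (max b 0 ^ (-(1 / p))))) (nhdsWithin a (Set.Iio a))
      (nhds (volume (Metric.ball (0 : EuclideanSpace ℝ (Fin (d + 1)))
        (max a 0 ^ (-(1 / p)))))) := by
    have h (b : ℝ) := Measure.addHaar_ball volume (0 : EuclideanSpace ℝ (Fin (d + 1)))
      (r := max b 0 ^ (-(1 / p))) (by positivity)
    simp only [h]
    have hc : ContinuousAt (fun b : ℝ => max b 0 ^ (-(1 / p))) a :=
      ContinuousAt.rpow_const (by fun_prop) (Or.inl (by simp [ha]))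
    exact ENNReal.Tendsto.mul_const ((ENNReal.continuous_ofReal.tendsto _).comp
      ((hc.pow _).tendsto.mono_left nhdsWithin_le_nhds)) (Or.inr measure_ball_lt_top.ne)
  rw [max_eq_left ha.le] at hlim
  refine ge_of_tendsto hlim ?_
  filter_upwards [Ioo_mem_nhdsLT ha] with b hb
  rw [max_eq_left hb.1.le]
  exact key b hb.1 hb.2
end

section
variable {d : ℕ} {e : EuclideanSpace ℝ (Fin (d + 1))} {p R r : ℝ}

lemma lintegral_Ioi_rpow_mul_exp_neg_sq {q : ℝ} (hq : -1 < q) :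
    ∫⁻ s in Set.Ioi (0 : ℝ), ENNReal.ofReal s ^ q * ENNReal.ofReal (rexp (-s ^ 2)) =
      ENNReal.ofReal (Gamma ((q + 1) / 2) / 2) := by
  have h1 := integral_rpow_mul_exp_neg_rpow (p := 2) (q := q) (by norm_num) hq
  have h2 := integrableOn_rpow_mul_exp_neg_rpow (s := q) (p := 2) hq (by norm_num)
  rw [div_eq_inv_mul, ← one_div, ← h1, ofReal_integral_eq_lintegral_ofReal h2]
  · refine setLIntegral_congr_fun measurableSet_Ioi fun s hs => ?_
    have hs : 0 < s := hs
    rw [ENNReal.ofReal_mul (by positivity), ENNReal.ofReal_rpow_of_pos hs, Real.rpow_two]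
  · filter_upwards [ae_restrict_mem measurableSet_Ioi] with s hs
    have hs : 0 < s := hs
    positivity

/-- The `p`-th one-sided moment of the surface measure of the unit sphere of `ℝ^(d + 1)`. -/
noncomputable def sphereMoment (d : ℕ) (p : ℝ) : ℝ :=
  Gamma ((p + 1) / 2) * π ^ ((d : ℝ) / 2) / Gamma ((d + p + 1) / 2)

lemma sphereMoment_pos (hp : 0 < p) : 0 < sphereMoment d p := by
  have h1 : 0 < Gamma ((p + 1) / 2) := Gamma_pos_of_pos (by positivity)
  have h2 : 0 < Gamma ((d + p + 1) / 2) := Gamma_pos_of_pos (by positivity)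
  rw [sphereMoment]; positivity

lemma lintegral_toSphere_inner_rpow (he : ‖e‖ = 1) (hp : 0 < p) :
    ∫⁻ ξ, ENNReal.ofReal ⟪(ξ : EuclideanSpace ℝ (Fin (d + 1))), e⟫ ^ p ∂(surface d) =
      ENNReal.ofReal (sphereMoment d p) := by
  obtain ⟨L, hL⟩ := IsFrame.exists he
  set Z := ∫⁻ z, ENNReal.ofReal (rexp (-‖L z‖ ^ 2)) with hZ
  have hexp (z : Fin d → ℝ) (t : ℝ) : ENNReal.ofReal (rexp (-‖L z + t • e‖ ^ 2)) =
      ENNReal.ofReal (rexp (-‖L z‖ ^ 2)) * ENNReal.ofReal (rexp (-t ^ 2)) := by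
    rw [← ENNReal.ofReal_mul (by positivity), ← Real.exp_add, hL.norm_sq, neg_add]
  have hLm : Measurable L := L.continuous_of_finiteDimensional.measurable
  have hA : ∫⁻ t : ℝ, ENNReal.ofReal t ^ p * ENNReal.ofReal (rexp (-t ^ 2)) =
      ENNReal.ofReal (Gamma ((p + 1) / 2) / 2) := by
    rw [← lintegral_Ioi_rpow_mul_exp_neg_sq (by linarith), ← lintegral_indicator measurableSet_Ioi]
    refine lintegral_congr fun t => ?_
    by_cases ht : 0 < t
    · rw [Set.indicator_of_mem (by exact ht)]
    · rw [Set.indicator_of_notMem (by exact ht), ENNReal.ofReal_eq_zero.2 (not_lt.1 ht),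
        ENNReal.zero_rpow_of_pos hp, zero_mul]
  have hB : ∫⁻ t : ℝ, ENNReal.ofReal (rexp (-t ^ 2)) = ENNReal.ofReal (√π) := by
    have h1 := integral_gaussian 1
    have h2 := integrable_exp_neg_mul_sq (b := 1) one_pos
    simp only [neg_mul, one_mul, div_one] at h1 h2
    rw [← h1, ofReal_integral_eq_lintegral_ofReal h2
      (Filter.Eventually.of_forall fun t => by positivity)]
  have hC : ∫⁻ x, ENNReal.ofReal ⟪x, e⟫ ^ p * ENNReal.ofReal (rexp (-‖x‖ ^ 2)) =
      Z * ENNReal.ofReal (Gamma ((p + 1) / 2) / 2) := by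
    rw [hL.lintegral_eq (by fun_prop), ← hA, hZ, ← lintegral_mul_const _ (by fun_prop)]
    refine lintegral_congr fun z => ?_
    rw [← lintegral_const_mul _ (by fun_prop)]
    refine lintegral_congr fun t => ?_
    rw [hexp, inner_add_left, hL.inner_eq_zero, inner_smul_left, hL.inner_self]
    simp only [conj_trivial, mul_one, zero_add]
    ring
  have hD : Z * ENNReal.ofReal (√π) = ENNReal.ofReal (π ^ (((d + 1 : ℕ) : ℝ) / 2)) := by
    rw [← hB, hZ, ← lintegral_mul_const _ (by fun_prop)]
    have h1 := GaussianFourier.integral_rexp_neg_mul_sq_norm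
      (V := EuclideanSpace ℝ (Fin (d + 1))) (b := 1) one_pos
    simp only [neg_mul, one_mul, div_one, finrank_euclideanSpace, Fintype.card_fin] at h1
    have h2 : Integrable fun v : EuclideanSpace ℝ (Fin (d + 1)) => rexp (-‖v‖ ^ 2) := by
      by_contra h
      rw [integral_undef h] at h1
      exact absurd h1 (by positivity)
    rw [← h1, ofReal_integral_eq_lintegral_ofReal h2
      (Filter.Eventually.of_forall fun t => by positivity), hL.lintegral_eq (by fun_prop)]
    refine lintegral_congr fun z => ?_
    rw [← lintegral_const_mul _ (by fun_prop)]
    exact lintegral_congr fun t => (hexp z t).symm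
  have hE : ∫⁻ x, ENNReal.ofReal ⟪x, e⟫ ^ p * ENNReal.ofReal (rexp (-‖x‖ ^ 2)) =
      (∫⁻ ξ, ENNReal.ofReal ⟪(ξ : EuclideanSpace ℝ (Fin (d + 1))), e⟫ ^ p ∂(surface d)) *
        ENNReal.ofReal (Gamma ((d + p + 1) / 2) / 2) := by
    rw [lintegral_eq_lintegral_toSphere (by fun_prop), ← lintegral_Ioi_rpow_mul_exp_neg_sq
      (by have : (0 : ℝ) ≤ d := by positivity
          linarith), ← lintegral_mul_const _ (by fun_prop)]
    refine lintegral_congr fun ξ => ?_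
    rw [← lintegral_const_mul _ (by fun_prop)]
    refine setLIntegral_congr_fun measurableSet_Ioi fun s hs => ?_
    have hs : 0 < s := hs
    rw [inner_smul_left, norm_smul, norm_eq_of_mem_sphere, mul_one, norm_of_nonneg hs.le,
      conj_trivial, ENNReal.ofReal_mul hs.le, ENNReal.mul_rpow_of_nonneg _ _ hp.le,
      ENNReal.rpow_add_of_nonneg _ _ (by positivity) hp.le, ENNReal.rpow_natCast]
    ring
  have hG1 : 0 < Gamma ((p + 1) / 2) := Gamma_pos_of_pos (by positivity)
  have hG2 : 0 < Gamma ((d + p + 1) / 2) := Gamma_pos_of_pos (by positivity)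
  have hπ : π ^ (((d + 1 : ℕ) : ℝ) / 2) = π ^ ((d : ℝ) / 2) * √π := by
    rw [Real.sqrt_eq_rpow, ← Real.rpow_add pi_pos]
    congr 1; push_cast; ring
  have hZv : Z = ENNReal.ofReal (π ^ ((d : ℝ) / 2)) := by
    rw [hπ, ENNReal.ofReal_mul (by positivity)] at hD
    exact (ENNReal.mul_left_inj (by simp [pi_pos]) ENNReal.ofReal_ne_top).1 hD
  rw [hC, hZv, ← ENNReal.ofReal_mul (by positivity)] at hE
  have : π ^ ((d : ℝ) / 2) * (Gamma ((p + 1) / 2) / 2) =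
      sphereMoment d p * (Gamma ((d + p + 1) / 2) / 2) := by
    rw [sphereMoment]; field_simp
  rw [this, ENNReal.ofReal_mul (sphereMoment_pos hp).le] at hE
  exact ((ENNReal.mul_left_inj (by simpa using hG2) ENNReal.ofReal_ne_top).1 hE).symm

lemma lintegral_ball_inner_rpow (hp : 0 < p) (hr : 0 ≤ r) (y : EuclideanSpace ℝ (Fin (d + 1))) :
    ∫⁻ x in Metric.ball 0 r, ENNReal.ofReal ⟪x, y⟫ ^ p =
      ENNReal.ofReal (sphereMoment d p * (r ^ (d + p + 1) / (d + p + 1)) * ‖y‖ ^ p) := by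
  rcases eq_or_ne y 0 with rfl | hy
  · simp [hp, hp.ne']
  have hy' : 0 < ‖y‖ := norm_pos_iff.2 hy
  set e := ‖y‖⁻¹ • y with he
  have he1 : ‖e‖ = 1 := by rw [he, norm_smul, norm_inv, norm_norm, inv_mul_cancel₀ hy'.ne']
  have hye : y = ‖y‖ • e := by rw [he, smul_smul, mul_inv_cancel₀ hy'.ne', one_smul]
  have h1 : ∫⁻ s in Set.Ioo 0 r, ENNReal.ofReal s ^ ((d : ℝ) + p) =
      ENNReal.ofReal (r ^ (d + p + 1) / (d + p + 1)) := by
    have hd : (0 : ℝ) ≤ d := by positivity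
    have h := integral_rpow (a := 0) (b := r) (r := d + p) (Or.inl (by linarith))
    rw [Real.zero_rpow (by positivity), sub_zero, intervalIntegral.integral_of_le hr,
      integral_Ioc_eq_integral_Ioo] at h
    rw [← h, ofReal_integral_eq_lintegral_ofReal]
    · exact setLIntegral_congr_fun measurableSet_Ioo fun s hs =>
        ENNReal.ofReal_rpow_of_pos hs.1
    · exact ((intervalIntegrable_iff_integrableOn_Ioo_of_le hr).1
        (intervalIntegral.intervalIntegrable_rpow' (by linarith)))
    · filter_upwards [ae_restrict_mem measurableSet_Ioo] with s hs
      have := hs.1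
      positivity
  rw [← lintegral_indicator measurableSet_ball, lintegral_eq_lintegral_toSphere
    (Measurable.indicator (by fun_prop) measurableSet_ball),
    ENNReal.ofReal_mul (mul_nonneg (sphereMoment_pos hp).le (by positivity)),
    ENNReal.ofReal_mul (sphereMoment_pos hp).le, ← lintegral_toSphere_inner_rpow he1 hp,
    mul_assoc, ← h1, ← lintegral_mul_const _ (by fun_prop)]
  refine lintegral_congr fun ξ => ?_
  rw [← lintegral_mul_const _ (by fun_prop), ← lintegral_const_mul _ (by fun_prop),
    ← lintegral_indicator measurableSet_Ioi, ← lintegral_indicator measurableSet_Ioo]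
  refine lintegral_congr fun s => ?_
  by_cases hs : 0 < s
  · rw [Set.indicator_of_mem (by exact hs)]
    have hn : ‖s • (ξ : EuclideanSpace ℝ (Fin (d + 1)))‖ = s := by
      rw [norm_smul, norm_eq_of_mem_sphere, mul_one, norm_of_nonneg hs.le]
    by_cases hsr : s < r
    · rw [Set.indicator_of_mem (by simpa [hn] using hsr), Set.indicator_of_mem (by exact ⟨hs, hsr⟩)]
      nth_rw 1 [hye]
      rw [inner_smul_left, inner_smul_right, conj_trivial, ENNReal.ofReal_mul hs.le,
        ENNReal.ofReal_mul hy'.le, ENNReal.mul_rpow_of_nonneg _ _ hp.le,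
        ENNReal.mul_rpow_of_nonneg _ _ hp.le, ENNReal.ofReal_rpow_of_pos hy',
        ENNReal.rpow_add_of_nonneg _ _ (by positivity) hp.le, ENNReal.rpow_natCast]
      ring
    · rw [Set.indicator_of_notMem (by simpa [hn] using hsr), mul_zero,
        Set.indicator_of_notMem (by exact fun h => hsr h.2)]
  · rw [Set.indicator_of_notMem (by exact hs), Set.indicator_of_notMem (by exact fun h => hs h.1)]
end

section
variable {d : ℕ} {e : EuclideanSpace ℝ (Fin (d + 1))} {p R r : ℝ}
  {f g : EuclideanSpace ℝ (Fin (d + 1)) → ℝ≥0∞}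

lemma lintegral_toSphere_oneSidedMoment (hp : 0 < p) (hf : Measurable f) :
    ∫⁻ ξ, oneSidedMoment p f (ξ : EuclideanSpace ℝ (Fin (d + 1))) ^ (-((d + 1 : ℕ) : ℝ) / p)
      ∂(surface d) = (d + 1 : ℕ) * polarVolume p f := by
  have hG := measurable_momentGauge (p := p) hf
  have hset : MeasurableSet {y | momentGauge p f y < 1} := measurableSet_lt hG measurable_const
  rw [polarVolume, ← lintegral_indicator_one hset,
    lintegral_eq_lintegral_toSphere (measurable_one.indicator hset), ← lintegral_const_mul']
  · refine lintegral_congr fun ξ => ?_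
    have h1 : ∫⁻ s in Set.Ioi (0 : ℝ), ENNReal.ofReal s ^ d *
        {y | momentGauge p f y < 1}.indicator 1 (s • (ξ : EuclideanSpace ℝ (Fin (d + 1)))) =
        ∫⁻ s in Set.Ioi (0 : ℝ), ENNReal.ofReal s ^ d *
          {t : ℝ | ENNReal.ofReal t < (momentGauge p f ξ)⁻¹}.indicator 1 s := by
      refine setLIntegral_congr_fun measurableSet_Ioi fun s hs => ?_
      have hs : 0 < s := hs
      have : ENNReal.ofReal s * momentGauge p f ξ < 1 ↔
          ENNReal.ofReal s < (momentGauge p f ξ)⁻¹ := by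
        rw [← one_div, ENNReal.lt_div_iff_mul_lt (Or.inr ENNReal.ofReal_ne_top)
          (Or.inr (by simpa using hs))]
      simp only [Set.indicator, Set.mem_ofPred_eq, momentGauge_smul hf hp hs, this,
        Pi.one_apply]
    rw [h1, lintegral_Ioi_pow_indicator, ENNReal.mul_div_cancel (by simp) (by simp), momentGauge,
      ← ENNReal.rpow_neg, ← ENNReal.rpow_natCast, ← ENNReal.rpow_mul]
    congr 1
    ring
  · simp

lemma lintegral_toSphere_oneSidedMoment_neg (hp : 0 < p) (hf : Measurable f) :
    ∫⁻ ξ, oneSidedMoment p f (-(ξ : EuclideanSpace ℝ (Fin (d + 1)))) ^ (-((d + 1 : ℕ) : ℝ) / p)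
      ∂(surface d) = (d + 1 : ℕ) * polarVolume p f := by
  have h (y) : oneSidedMoment p f (-y) = oneSidedMoment p (fun x => f (-x)) y := by
    rw [oneSidedMoment, oneSidedMoment, ← lintegral_neg_eq_self]
    simp
  simp only [h]
  rw [lintegral_toSphere_oneSidedMoment hp (f := fun x => f (-x)) (by fun_prop)]
  congr 1
  rw [polarVolume, polarVolume, ← Measure.measure_preimage_neg]
  congr 1
  ext y
  simp [momentGauge, ← h]

lemma exists_translate_lintegral_toSphere_le (hp : 1 ≤ p) (hR0 : 0 ≤ R) (hr : 0 < r)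
    (hf : Measurable f) (hf1 : ∀ x, f x ≤ 1) (hR : ∀ x, f x ≠ 0 → ‖x‖ ≤ R)
    (hm : ∫⁻ x, f x = volume (Metric.ball (0 : EuclideanSpace ℝ (Fin (d + 1))) r)) :
    ∃ c : EuclideanSpace ℝ (Fin (d + 1)), polarVolume p (fun x => f (x + c)) ≤
      volume (Metric.ball (0 : EuclideanSpace ℝ (Fin (d + 1)))
        ((sphereMoment d p * (r ^ (d + p + 1) / (d + p + 1))) ^ (-(1 / p)))) := by
  have hp0 : 0 < p := by linarith
  obtain ⟨c, g, hg, hg1, hgR, hgm, hge, hle⟩ := exists_translate_even hp hR0 hf hf1 hR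
  refine ⟨c, hle.trans (polarVolume_le_of_even hp hr.le (le_max_right R r) hg hg1
    (fun x hx => (hgR x hx).trans (le_max_left _ _)) hge (hgm.trans hm) ?_
    fun y => lintegral_ball_inner_rpow hp0 hr.le y)⟩
  have := sphereMoment_pos (d := d) hp0
  positivity

lemma rpow_neg_weighted_le {a b q : ℝ} (ha : 0 ≤ a) (hb : 0 < b) (hab : b + a = 1) (hq : q < 0)
    {X Y : ℝ≥0∞} (hX : X ≠ ⊤) (hY : Y ≠ ⊤) :
    (ENNReal.ofReal b * X + ENNReal.ofReal a * Y) ^ q ≤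
      ENNReal.ofReal b * X ^ q + ENNReal.ofReal a * Y ^ q := by
  rcases ha.eq_or_lt with rfl | ha
  · obtain rfl : b = 1 := by linarith
    simp
  rcases eq_or_ne X 0 with rfl | hX0
  · simp [ENNReal.zero_rpow_of_neg hq, ENNReal.mul_top, hb]
  rcases eq_or_ne Y 0 with rfl | hY0
  · simp [ENNReal.zero_rpow_of_neg hq, ENNReal.mul_top, ha]
  have hx := ENNReal.toReal_pos hX0 hX
  have hy := ENNReal.toReal_pos hY0 hY
  rw [← ENNReal.ofReal_toReal hX, ← ENNReal.ofReal_toReal hY, ← ENNReal.ofReal_mul hb.le,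
    ← ENNReal.ofReal_mul ha.le, ← ENNReal.ofReal_add (by positivity) (by positivity),
    ENNReal.ofReal_rpow_of_pos (by positivity), ENNReal.ofReal_rpow_of_pos hx,
    ENNReal.ofReal_rpow_of_pos hy, ← ENNReal.ofReal_mul hb.le,
    ← ENNReal.ofReal_mul ha.le, ← ENNReal.ofReal_add (by positivity) (by positivity)]
  refine ENNReal.ofReal_le_ofReal ?_
  have h1 := Real.geom_mean_le_arith_mean2_weighted hb.le ha.le hx.le hy.le hab
  have h2 := Real.geom_mean_le_arith_mean2_weighted hb.le ha.le
    (p₁ := X.toReal ^ q) (p₂ := Y.toReal ^ q) (by positivity) (by positivity) hab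
  refine (Real.rpow_le_rpow_of_nonpos (by positivity) h1 hq.le).trans (le_trans (le_of_eq ?_) h2)
  rw [Real.mul_rpow (by positivity) (by positivity), ← Real.rpow_mul hx.le, ← Real.rpow_mul hy.le,
    ← Real.rpow_mul hx.le, ← Real.rpow_mul hy.le, mul_comm b, mul_comm a]
end

section
variable {d : ℕ} {e : EuclideanSpace ℝ (Fin (d + 1))} {p R r : ℝ}
  {f g : EuclideanSpace ℝ (Fin (d + 1)) → ℝ≥0∞}

lemma Rnp_eq (hp : 0 < p) {W : ℝ}
    (hW : W = √π ^ (d + 1) / Gamma (((d + 1 : ℕ) : ℝ) / 2 + 1)) :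
    Rnp (d + 1) p = W ^ 2 *
      (W / (sphereMoment d p / (d + p + 1))) ^ (((d + 1 : ℕ) : ℝ) / p) := by
  have hd : (0 : ℝ) ≤ d := by positivity
  have h1 : 0 < Gamma ((((d + 1 : ℕ) : ℝ) + 2) / 2) := Gamma_pos_of_pos (by positivity)
  have h2 : 0 < Gamma ((p + 1) / 2) := Gamma_pos_of_pos (by positivity)
  have h3 : 0 < Gamma ((d + p + 1) / 2) := Gamma_pos_of_pos (by positivity)
  have h4 : Gamma ((((d + 1 : ℕ) : ℝ) + p + 2) / 2) =
      (d + p + 1) / 2 * Gamma ((d + p + 1) / 2) := by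
    rw [← Gamma_add_one (by positivity)]
    congr 1; push_cast; ring
  have h5 : ((d + 1 : ℕ) : ℝ) / 2 + 1 = (((d + 1 : ℕ) : ℝ) + 2) / 2 := by ring
  have hπ : √π ^ (d + 1) = π ^ ((d : ℝ) / 2) * √π := by
    rw [pow_succ, Real.sqrt_eq_rpow, ← Real.rpow_natCast, ← Real.rpow_mul pi_pos.le]
    congr 2; ring
  have hW2 : W ^ 2 = π ^ (d + 1) / Gamma ((((d + 1 : ℕ) : ℝ) + 2) / 2) ^ 2 := by
    rw [hW, h5, div_pow, ← pow_mul, mul_comm, pow_mul, Real.sq_sqrt pi_pos.le]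
  have hq : W / (sphereMoment d p / (d + p + 1)) = √π *
      (2 * Gamma ((((d + 1 : ℕ) : ℝ) + p + 2) / 2) /
        (Gamma ((((d + 1 : ℕ) : ℝ) + 2) / 2) * Gamma ((p + 1) / 2))) := by
    rw [hW, h4, h5, hπ, sphereMoment]
    field_simp
  rw [hq, hW2, Rnp, Real.mul_rpow (by positivity) (by rw [h4]; positivity), Real.sqrt_eq_rpow,
    ← Real.rpow_mul pi_pos.le, Real.rpow_add pi_pos, Real.rpow_natCast]
  have : 1 / 2 * (((d + 1 : ℕ) : ℝ) / p) = ((d + 1 : ℕ) : ℝ) / (2 * p) := by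
    field_simp
  rw [this]
  ring

lemma Rnp_pos (hp : 0 < p) : 0 < Rnp (d + 1) p := by
  have h1 : 0 < Gamma (((d + 1 : ℕ) : ℝ) / 2 + 1) := Gamma_pos_of_pos (by positivity)
  have := sphereMoment_pos (d := d) hp
  rw [Rnp_eq hp rfl]
  positivity

/-- The polar volume of the centred ball of volume `m`, in terms of `Rnp`. -/
lemma volume_ball_eq_Rnp (hp : 0 < p) (hr : 0 < r) {m : ℝ} (hm0 : 0 < m)
    (hm : volume (Metric.ball (0 : EuclideanSpace ℝ (Fin (d + 1))) r) = ENNReal.ofReal m) :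
    volume (Metric.ball (0 : EuclideanSpace ℝ (Fin (d + 1)))
        ((sphereMoment d p * (r ^ (d + p + 1) / (d + p + 1))) ^ (-(1 / p)))) =
      ENNReal.ofReal (Rnp (d + 1) p * m ^ (-(((d + 1 : ℕ) : ℝ) + p) / p)) := by
  have hΓ : 0 < Gamma (((d + 1 : ℕ) : ℝ) / 2 + 1) := Gamma_pos_of_pos (by positivity)
  have hμ := sphereMoment_pos (d := d) hp
  set W := √π ^ (d + 1) / Gamma (((d + 1 : ℕ) : ℝ) / 2 + 1) with hW
  have hW0 : 0 < W := by positivity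
  set c := sphereMoment d p / (d + p + 1) with hc
  have hc0 : 0 < c := by positivity
  have hac : sphereMoment d p * (r ^ (d + p + 1) / (d + p + 1)) =
      c * r ^ (d + p + 1) := by rw [hc]; ring
  have hball (ρ : ℝ) (hρ : 0 ≤ ρ) : volume (Metric.ball (0 : EuclideanSpace ℝ (Fin (d + 1))) ρ) =
      ENNReal.ofReal (ρ ^ (d + 1) * W) := by
    rw [EuclideanSpace.volume_ball, Fintype.card_fin, ENNReal.ofReal_mul (by positivity),
      ENNReal.ofReal_pow hρ]
  rw [hball r hr.le, ENNReal.ofReal_eq_ofReal_iff (by positivity) hm0.le] at hm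
  rw [hac, hball _ (by positivity), Rnp_eq hp hW, ← hm]
  congr 1
  rw [Real.mul_rpow (by positivity) (by positivity), Real.mul_rpow (by positivity) hW0.le,
    Real.div_rpow hW0.le hc0.le, ← Real.rpow_natCast, ← Real.rpow_natCast r,
    ← Real.rpow_mul hr.le, ← Real.rpow_mul hr.le, Real.mul_rpow (by positivity) (by positivity),
    ← Real.rpow_mul hr.le, ← Real.rpow_mul hc0.le]
  have e1 : (d + p + 1) * -(1 / p) * ((d + 1 : ℕ) : ℝ) =
      ((d + 1 : ℕ) : ℝ) * (-(((d + 1 : ℕ) : ℝ) + p) / p) := by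
    push_cast; field_simp; ring
  have e2 : -(1 / p) * ((d + 1 : ℕ) : ℝ) = -(((d + 1 : ℕ) : ℝ) / p) := by ring
  have e3 : -(((d + 1 : ℕ) : ℝ) + p) / p = -(((d + 1 : ℕ) : ℝ) / p) - 1 := by
    field_simp; ring
  rw [e1, e2, e3, Real.rpow_sub_one hW0.ne', Real.rpow_neg hW0.le, Real.rpow_neg hc0.le]
  field_simp
end

section
variable {d : ℕ} {p : ℝ}

lemma exists_volume_ball_eq {m : ℝ} (hm : 0 < m) :
    ∃ r, 0 < r ∧ volume (Metric.ball (0 : EuclideanSpace ℝ (Fin (d + 1))) r) =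
      ENNReal.ofReal m := by
  have hΓ : 0 < Gamma (((d + 1 : ℕ) : ℝ) / 2 + 1) := Gamma_pos_of_pos (by positivity)
  set W := √π ^ (d + 1) / Gamma (((d + 1 : ℕ) : ℝ) / 2 + 1) with hW
  have hW0 : 0 < W := by positivity
  refine ⟨(m / W) ^ (((d + 1 : ℕ) : ℝ)⁻¹), by positivity, ?_⟩
  rw [EuclideanSpace.volume_ball, Fintype.card_fin, ← hW, ← ENNReal.ofReal_pow (by positivity),
    ← ENNReal.ofReal_mul (by positivity), Real.rpow_inv_natCast_pow (by positivity) (by simp),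
    div_mul_cancel₀ _ hW0.ne']

variable {f : EuclideanSpace ℝ (Fin (d + 1)) → ℝ}

lemma exists_translate_polarVolume_le (hp : 1 ≤ p) (hf_cont : Continuous f)
    (hf_nonneg : ∀ x, 0 ≤ f x) (hf_supp : HasCompactSupport f) (hf_ne : f ≠ 0) :
    ∃ c : EuclideanSpace ℝ (Fin (d + 1)), (d + 1 : ℕ) * polarVolume p
        (fun x => ENNReal.ofReal (f (x + c))) ≤
      ENNReal.ofReal ((d + 1 : ℕ) * Rnp (d + 1) p * (⨆ x, f x) *
        (∫ x, f x) ^ (-(((d + 1 : ℕ) : ℝ) + p) / p)) := by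
  have hp0 : 0 < p := by linarith
  have hbdd : BddAbove (Set.range f) := hf_cont.bddAbove_range_of_hasCompactSupport hf_supp
  set M := ⨆ x, f x with hM
  set F := ∫ x, f x with hF
  have hfM (x) : f x ≤ M := le_ciSup hbdd x
  have hM0 : 0 < M := by
    obtain ⟨x, hx⟩ := Function.ne_iff.1 hf_ne
    exact ((hf_nonneg x).lt_of_ne' hx).trans_le (hfM x)
  have hF0 : 0 < F :=
    let ⟨x, hx⟩ := Function.ne_iff.1 hf_ne
    hf_cont.integral_pos_of_hasCompactSupport_nonneg_nonzero hf_supp hf_nonneg hx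
  obtain ⟨R, hR0, hR⟩ := hf_supp.isCompact.isBounded.subset_closedBall_lt 0 0
  obtain ⟨r, hr, hrv⟩ := exists_volume_ball_eq (d := d) (div_pos hF0 hM0)
  have hfm : Measurable f := hf_cont.measurable
  have hmass : ∫⁻ x, ENNReal.ofReal (f x / M) = ENNReal.ofReal (F / M) := by
    rw [hF, ← integral_div, ofReal_integral_eq_lintegral_ofReal
      ((hf_cont.integrable_of_hasCompactSupport hf_supp).div_const _)
      (Filter.Eventually.of_forall fun x => div_nonneg (hf_nonneg x) hM0.le)]
  obtain ⟨c, hc⟩ := exists_translate_lintegral_toSphere_le (f := fun x => ENNReal.ofReal (f x / M))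
    hp hR0.le hr (by fun_prop)
    (fun x => ENNReal.ofReal_le_one.2 ((div_le_one hM0).2 (hfM x)))
    (fun x hx => by
      have : f x ≠ 0 := fun h => hx (by simp [h])
      simpa using hR (subset_tsupport f this)) (hmass.trans hrv.symm)
  rw [volume_ball_eq_Rnp hp0 hr (div_pos hF0 hM0) hrv] at hc
  refine ⟨c, ?_⟩
  rw [← lintegral_toSphere_oneSidedMoment hp0 (by fun_prop)]
  have h1 (y : EuclideanSpace ℝ (Fin (d + 1))) :
      oneSidedMoment p (fun x => ENNReal.ofReal (f (x + c))) y =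
      ENNReal.ofReal M * oneSidedMoment p (fun x => ENNReal.ofReal (f (x + c) / M)) y := by
    rw [oneSidedMoment, oneSidedMoment, ← lintegral_const_mul _ (by fun_prop)]
    refine lintegral_congr fun x => ?_
    rw [← mul_assoc, ← ENNReal.ofReal_mul hM0.le, mul_div_cancel₀ _ hM0.ne']
  have h2 (y : EuclideanSpace ℝ (Fin (d + 1))) :
      oneSidedMoment p (fun x => ENNReal.ofReal (f (x + c))) y ^ (-((d + 1 : ℕ) : ℝ) / p) =
      ENNReal.ofReal (M ^ (-((d + 1 : ℕ) : ℝ) / p)) *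
        oneSidedMoment p (fun x => ENNReal.ofReal (f (x + c) / M)) y ^
          (-((d + 1 : ℕ) : ℝ) / p) := by
    rw [h1, ENNReal.mul_rpow_eq_ite, if_neg (by simp [hM0.not_ge]), ENNReal.ofReal_rpow_of_pos hM0]
  simp only [h2]
  rw [lintegral_const_mul' _ _ ENNReal.ofReal_ne_top,
    lintegral_toSphere_oneSidedMoment hp0 (by fun_prop)]
  calc _ ≤ ENNReal.ofReal (M ^ (-((d + 1 : ℕ) : ℝ) / p)) * ((d + 1 : ℕ) * ENNReal.ofReal
        (Rnp (d + 1) p * (F / M) ^ (-(((d + 1 : ℕ) : ℝ) + p) / p))) := by gcongr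
    _ = _ := by
      have hRn := Rnp_pos (d := d) hp0
      rw [← ENNReal.ofReal_natCast, ← ENNReal.ofReal_mul (by positivity),
        ← ENNReal.ofReal_mul (by positivity)]
      congr 1
      have e3 : -(((d + 1 : ℕ) : ℝ) + p) / p = -((d + 1 : ℕ) : ℝ) / p - 1 := by
        field_simp; ring
      rw [Real.div_rpow hF0.le hM0.le, e3, Real.rpow_sub_one hM0.ne']
      field_simp

lemma integrable_mul_max_inner_rpow (hp : 0 < p) (hf_cont : Continuous f)
    (hf_supp : HasCompactSupport f) (y : EuclideanSpace ℝ (Fin (d + 1))) :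
    Integrable fun x => f x * max ⟪x, y⟫ 0 ^ p := by
  refine Continuous.integrable_of_hasCompactSupport ?_ hf_supp.mul_right
  exact hf_cont.mul (Continuous.rpow_const (by fun_prop) fun _ => Or.inr hp.le)

lemma oneSidedMoment_ofReal (hp : 0 < p) (hf_cont : Continuous f)
    (hf_nonneg : ∀ x, 0 ≤ f x) (hf_supp : HasCompactSupport f)
    (y : EuclideanSpace ℝ (Fin (d + 1))) :
    oneSidedMoment p (fun x => ENNReal.ofReal (f x)) y =
      ENNReal.ofReal (∫ x, f x * max ⟪x, y⟫ 0 ^ p) := by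
  have h0 (x) : 0 ≤ max ⟪x, y⟫ 0 ^ p := by positivity
  rw [ofReal_integral_eq_lintegral_ofReal (integrable_mul_max_inner_rpow hp hf_cont hf_supp y)
    (Filter.Eventually.of_forall fun x => mul_nonneg (hf_nonneg x) (h0 x)), oneSidedMoment]
  refine lintegral_congr fun x => ?_
  rw [ENNReal.ofReal_mul (hf_nonneg x), ← ENNReal.ofReal_rpow_of_nonneg (by positivity) hp.le,
    ENNReal.ofReal_max]
  simp

lemma integral_mul_epsPow (hp : 0 < p) (hf_cont : Continuous f)
    (hf_nonneg : ∀ x, 0 ≤ f x) (hf_supp : HasCompactSupport f) {eps : ℝ} (h0 : 0 ≤ eps)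
    (h1 : eps ≤ 1) (y : EuclideanSpace ℝ (Fin (d + 1))) :
    ∫ x, f x * epsPow eps p ⟪x, y⟫ =
      (ENNReal.ofReal (1 - eps) * oneSidedMoment p (fun x => ENNReal.ofReal (f x)) y +
        ENNReal.ofReal eps * oneSidedMoment p (fun x => ENNReal.ofReal (f x)) (-y)).toReal := by
  have hi (y) : 0 ≤ ∫ x, f x * max ⟪x, y⟫ 0 ^ p :=
    integral_nonneg fun x => mul_nonneg (hf_nonneg x) (by positivity)
  have h1' : 0 ≤ 1 - eps := by linarith
  rw [oneSidedMoment_ofReal hp hf_cont hf_nonneg hf_supp,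
    oneSidedMoment_ofReal hp hf_cont hf_nonneg hf_supp, ← ENNReal.ofReal_mul h1',
    ← ENNReal.ofReal_mul h0, ← ENNReal.ofReal_add (mul_nonneg h1' (hi _)) (mul_nonneg h0 (hi _)),
    ENNReal.toReal_ofReal (add_nonneg (mul_nonneg h1' (hi _)) (mul_nonneg h0 (hi _))),
    ← integral_const_mul, ← integral_const_mul, ← integral_add
      ((integrable_mul_max_inner_rpow hp hf_cont hf_supp y).const_mul _)
      ((integrable_mul_max_inner_rpow hp hf_cont hf_supp (-y)).const_mul _)]
  refine integral_congr_ae (Filter.Eventually.of_forall fun x => ?_)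
  simp only [epsPow, inner_neg_right]
  ring

lemma integral_toSphere_bounds (hp : 0 < p) (hf_cont : Continuous f)
    (hf_nonneg : ∀ x, 0 ≤ f x) (hf_supp : HasCompactSupport f) {eps : ℝ} (h0 : 0 ≤ eps)
    (h1 : eps < 1) {b : ℝ} (hb : 0 ≤ b)
    (hle : (d + 1 : ℕ) * polarVolume p (fun x => ENNReal.ofReal (f x)) ≤ ENNReal.ofReal b) :
    0 < ∫ ξ, (∫ x, f x * epsPow eps p ⟪x, (ξ : EuclideanSpace ℝ (Fin (d + 1)))⟫) ^
        (-((d + 1 : ℕ) : ℝ) / p) ∂(surface d) ∧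
      ∫ ξ, (∫ x, f x * epsPow eps p ⟪x, (ξ : EuclideanSpace ℝ (Fin (d + 1)))⟫) ^
        (-((d + 1 : ℕ) : ℝ) / p) ∂(surface d) ≤ b := by
  set A := oneSidedMoment p (fun x => ENNReal.ofReal (f x)) with hA
  have hfm : Measurable fun x => ENNReal.ofReal (f x) := hf_cont.measurable.ennreal_ofReal
  have hAm : Measurable A := measurable_oneSidedMoment hfm
  have hAtop (y) : A y ≠ ⊤ := by
    rw [hA, oneSidedMoment_ofReal hp hf_cont hf_nonneg hf_supp]
    exact ENNReal.ofReal_ne_top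
  set q := -((d + 1 : ℕ) : ℝ) / p with hq
  have hq0 : q < 0 := div_neg_of_neg_of_pos (neg_lt_zero.2 (by positivity)) hp
  set T : Metric.sphere (0 : EuclideanSpace ℝ (Fin (d + 1))) 1 → ℝ≥0∞ := fun ξ =>
    ENNReal.ofReal (1 - eps) * A ξ + ENNReal.ofReal eps * A (-ξ) with hT
  have hTm : Measurable T := by fun_prop
  have hTtop (ξ) : T ξ ≠ ⊤ := ENNReal.add_ne_top.2
    ⟨ENNReal.mul_ne_top ENNReal.ofReal_ne_top (hAtop _),
      ENNReal.mul_ne_top ENNReal.ofReal_ne_top (hAtop _)⟩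
  have hTle : ∫⁻ ξ, T ξ ^ q ∂(surface d) ≤ ENNReal.ofReal b := by
    calc ∫⁻ ξ, T ξ ^ q ∂(surface d)
        ≤ ∫⁻ ξ, (ENNReal.ofReal (1 - eps) * A ξ ^ q + ENNReal.ofReal eps * A (-ξ) ^ q)
            ∂(surface d) := lintegral_mono fun ξ =>
          rpow_neg_weighted_le h0 (by linarith) (by ring) hq0 (hAtop _) (hAtop _)
      _ = ENNReal.ofReal (1 - eps) * ((d + 1 : ℕ) * polarVolume p (fun x => ENNReal.ofReal (f x))) +
          ENNReal.ofReal eps * ((d + 1 : ℕ) * polarVolume p (fun x => ENNReal.ofReal (f x))) := by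
          rw [lintegral_add_left (by fun_prop), lintegral_const_mul _ (by fun_prop),
            lintegral_const_mul _ (by fun_prop), lintegral_toSphere_oneSidedMoment hp hfm,
            lintegral_toSphere_oneSidedMoment_neg hp hfm]
      _ = (d + 1 : ℕ) * polarVolume p (fun x => ENNReal.ofReal (f x)) := by
          rw [← add_mul, ← ENNReal.ofReal_add (by linarith) h0, sub_add_cancel, ENNReal.ofReal_one,
            one_mul]
      _ ≤ _ := hle
  have hTne : ∫⁻ ξ, T ξ ^ q ∂(surface d) ≠ ⊤ := ne_top_of_le_ne_top ENNReal.ofReal_ne_top hTle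
  have hI : ∫ ξ, (∫ x, f x * epsPow eps p ⟪x, (ξ : EuclideanSpace ℝ (Fin (d + 1)))⟫) ^ q
      ∂(surface d) = (∫⁻ ξ, T ξ ^ q ∂(surface d)).toReal := by
    rw [← integral_toReal (hTm.pow_const q).aemeasurable (ae_lt_top (hTm.pow_const q) hTne)]
    refine integral_congr_ae (Filter.Eventually.of_forall fun ξ => ?_)
    simp only
    rw [integral_mul_epsPow hp hf_cont hf_nonneg hf_supp h0 h1.le, ENNReal.toReal_rpow]
  rw [hI]
  refine ⟨ENNReal.toReal_pos (fun h => ?_) hTne, ENNReal.toReal_le_of_le_ofReal hb hTle⟩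
  rw [lintegral_eq_zero_iff (hTm.pow_const q)] at h
  have : (ae (surface d)).NeBot := ae_neBot.2 (Measure.toSphere_ne_zero volume)
  obtain ⟨ξ, hξ⟩ := h.exists
  rw [Pi.zero_apply, ENNReal.rpow_eq_zero_iff] at hξ
  rcases hξ with hξ | hξ
  · exact absurd hξ.2 (not_lt.2 hq0.le)
  · exact hTtop ξ hξ.1
end

/-- Asymmetric functional `L_p` Blaschke–Santaló inequality, case `λ = ∞`. -/
theorem functional_BS_asymmetric_top (n : ℕ) (hn : 2 ≤ n) (p : ℝ) (hp : 1 ≤ p)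
    (f : EuclideanSpace ℝ (Fin n) → ℝ) (hf_cont : Continuous f)
    (hf_nonneg : ∀ x, 0 ≤ f x) (hf_supp : HasCompactSupport f) (hf_ne : f ≠ 0) :
    ∃ c : EuclideanSpace ℝ (Fin n), ∀ eps : ℝ, 0 ≤ eps → eps < 1 / 2 →
      (∫ x, f x) ^ ((n : ℝ) + p) ≤
        (n : ℝ) ^ p * Rnp n p ^ p * (⨆ x, f x) ^ p *
          (∫ ξ : Metric.sphere (0 : EuclideanSpace ℝ (Fin n)) 1,
              (∫ x, f (x - c) * epsPow eps p ⟪x, (ξ : EuclideanSpace ℝ (Fin n))⟫) ^ (-(n : ℝ) / p)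
            ∂((volume : Measure (EuclideanSpace ℝ (Fin n))).toSphere)) ^ (-p) := by
  obtain ⟨d, rfl⟩ : ∃ d, n = d + 1 := ⟨n - 1, by omega⟩
  have hp0 : 0 < p := by linarith
  obtain ⟨c, hc⟩ := exists_translate_polarVolume_le hp hf_cont hf_nonneg hf_supp hf_ne
  have hM : 0 ≤ ⨆ x, f x := Real.iSup_nonneg hf_nonneg
  have hF : 0 ≤ ∫ x, f x := integral_nonneg hf_nonneg
  have hRn := Rnp_pos (d := d) hp0
  refine ⟨-c, fun eps h0 h1 => ?_⟩
  have hsupp : HasCompactSupport fun x => f (x + c) :=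
    hf_supp.comp_homeomorph (Homeomorph.addRight c)
  have hI := integral_toSphere_bounds (f := fun x => f (x + c)) hp0 (by fun_prop)
    (fun x => hf_nonneg _) hsupp h0 (by linarith) (by positivity) hc
  simp only [sub_neg_eq_add]
  have hB := hI.1.trans_le hI.2
  refine le_trans (le_of_eq ?_) (mul_le_mul_of_nonneg_left
    (Real.rpow_le_rpow_of_nonpos hI.1 hI.2 (by linarith)) (by positivity))
  have hd : (0 : ℝ) < ((d + 1 : ℕ) : ℝ) := by positivity
  have hM0 : 0 < ⨆ x, f x := by
    refine hM.lt_of_ne' fun h => ?_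
    simp [h] at hB
  rw [Real.mul_rpow (by positivity) (by positivity), Real.mul_rpow (by positivity) hM,
    Real.mul_rpow hd.le hRn.le, ← Real.rpow_mul hF, Real.rpow_neg hd.le, Real.rpow_neg hRn.le,
    Real.rpow_neg hM]
  have e : -(((d + 1 : ℕ) : ℝ) + p) / p * -p = ((d + 1 : ℕ) : ℝ) + p := by
    field_simp
  rw [e]
  have := Real.rpow_pos_of_pos hd p
  have := Real.rpow_pos_of_pos hRn p
  have := Real.rpow_pos_of_pos hM0 p
  field_simp
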